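/- arXiv:0709.0243 — 3 statements merged into one kernel-verified Lean document; each statement's English description precedes it below -/
import Mathlib

section
/- Let 1 < p < ∞, δ > 1, and let q*(p,δ) be the unique solution x > 1 of ((x/δ)^p − 1)/(x − 1) = p. If q > q*(p,δ), then every weight w ∈ RH_p^δ(I) on a bounded interval I ⊂ ℝ satisfies, for every subinterval J ⊂ I, ⟨w⟩_J · ⟨w^{1−q'}⟩_J^{q−1} ≤ (1/q*(p,δ)) · ((q−1)/(q−q*(p,δ)))^{q−1}. -/
open MeasureTheory Set ENNReal

/-- The average `⟨f⟩_{(a,b)}` of an `ℝ≥0∞`-valued function over an interval. -/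
noncomputable def avgE (f : ℝ → ℝ≥0∞) (a b : ℝ) : ℝ≥0∞ :=
  (∫⁻ t in Set.Ioo a b, f t) / ENNReal.ofReal (b - a)

/-- `w ∈ RH_p^δ([A,B])`: a weight (nonnegative measurable, locally integrable) whose
`p`-reverse-Hölder ratio is at most `δ` on every subinterval. -/
def MemRH (p δ A B : ℝ) (w : ℝ → ℝ≥0∞) : Prop :=
  Measurable w ∧ (∫⁻ t in Set.Ioo A B, w t) ≠ ⊤ ∧
    ∀ a b, A ≤ a → a < b → b ≤ B →
      avgE (fun t => w t ^ p) a b ≤ ENNReal.ofReal δ ^ p * (avgE w a b) ^ p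

theorem IsOpen.exists_connectedComponentIn_eq_Ioo {G : Set ℝ} (hG : IsOpen G)
    (hb : BddBelow G) (ha : BddAbove G) {x : ℝ} (hx : x ∈ G) :
    ∃ α β, α < β ∧ connectedComponentIn G x = Ioo α β ∧ α ∉ G ∧ β ∉ G := by
  set C := connectedComponentIn G x
  have hxC : x ∈ C := mem_connectedComponentIn hx
  have hCG : C ⊆ G := connectedComponentIn_subset G x
  have hCo : IsOpen C := hG.connectedComponentIn
  have hCp : IsPreconnected C := isPreconnected_connectedComponentIn
  have hCc : IsConnected C := ⟨⟨x, hxC⟩, hCp⟩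
  have hCb : BddBelow C := hb.mono hCG
  have hCa : BddAbove C := ha.mono hCG
  have hcl : ∀ y ∈ closure C, y ∈ G → y ∈ C := fun y hy hyG =>
    (hCp.subset_closure (subset_insert y C)
      (insert_subset hy subset_closure)).subset_connectedComponentIn
      (mem_insert_of_mem y hxC) (insert_subset hyG hCG) (mem_insert y C)
  have hα : sInf C ∉ C := fun h => by
    obtain ⟨l, hl, hlC⟩ := exists_Ioc_subset_of_mem_nhds (hCo.mem_nhds h) ⟨sInf C - 1, by linarith⟩
    have h1 : (l + sInf C) / 2 ∈ C := hlC ⟨by linarith, by linarith⟩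
    linarith [csInf_le hCb h1]
  have hβ : sSup C ∉ C := fun h => by
    obtain ⟨u, hu, huC⟩ := exists_Ico_subset_of_mem_nhds (hCo.mem_nhds h) ⟨sSup C + 1, by linarith⟩
    have h1 : (u + sSup C) / 2 ∈ C := huC ⟨by linarith, by linarith⟩
    linarith [le_csSup hCa h1]
  have hsub : C ⊆ Ioo (sInf C) (sSup C) := fun y hy =>
    ⟨(csInf_le hCb hy).lt_of_ne fun h => hα (h ▸ hy),
      (le_csSup hCa hy).lt_of_ne fun h => hβ (h ▸ hy)⟩
  refine ⟨sInf C, sSup C, (hsub hxC).1.trans (hsub hxC).2,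
    hsub.antisymm (hCc.Ioo_csInf_csSup_subset hCb hCa), fun h => ?_, fun h => ?_⟩
  · exact hα (hcl _ (csInf_mem_closure hCc.nonempty hCb) h)
  · exact hβ (hcl _ (csSup_mem_closure hCc.nonempty hCa) h)

/-- If the integral of `H` over every component of a bounded open set is nonpositive, then so is
the integral over the whole set. -/
theorem setIntegral_nonpos_of_connectedComponentIn {G : Set ℝ} (hG : IsOpen G) {H : ℝ → ℝ}
    (hH : IntegrableOn H G)
    (hc : ∀ x ∈ G, ∫ t in connectedComponentIn G x, H t ≤ 0) : ∫ t in G, H t ≤ 0 := by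
  set 𝒞 : Set (Set ℝ) := connectedComponentIn G '' G
  have hdis : 𝒞.PairwiseDisjoint id := by
    rintro _ ⟨x, hx, rfl⟩ _ ⟨y, hy, rfl⟩ hne
    refine disjoint_left.2 fun z hzx hzy => hne ?_
    rw [connectedComponentIn_eq hzx, connectedComponentIn_eq hzy]
  have hopen : ∀ C ∈ 𝒞, IsOpen (id C) := by
    rintro _ ⟨x, hx, rfl⟩
    exact hG.connectedComponentIn
  have hcount : 𝒞.Countable := hdis.countable_of_isOpen hopen (by
    rintro _ ⟨x, hx, rfl⟩
    exact ⟨x, mem_connectedComponentIn hx⟩)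
  have : Countable 𝒞 := hcount.to_subtype
  have hU : G = ⋃ C : 𝒞, (C : Set ℝ) := by
    ext x
    simp only [mem_iUnion]
    constructor
    · exact fun hx => ⟨⟨_, x, hx, rfl⟩, mem_connectedComponentIn hx⟩
    · rintro ⟨⟨_, y, hy, rfl⟩, h⟩
      exact connectedComponentIn_subset G y h
  rw [hU] at hH ⊢
  rw [integral_iUnion (s := fun C : 𝒞 => (C : Set ℝ)) (fun C => (hopen C C.2).measurableSet)
    (fun C D hCD => hdis C.2 D.2 (Subtype.coe_injective.ne hCD)) hH]
  refine tsum_nonpos ?_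
  rintro ⟨_, x, hx, rfl⟩
  exact hc x hx

/-- The points of `(a, c)` lying below the running maximum of `f`, started at `a`. -/
def shadow (f : ℝ → ℝ) (a c : ℝ) : Set ℝ := {t | t ∈ Ioo a c ∧ ∃ s ∈ Ico a t, f t < f s}

theorem isOpen_shadow {f : ℝ → ℝ} (hf : Continuous f) (a c : ℝ) : IsOpen (shadow f a c) := by
  rw [isOpen_iff_mem_nhds]
  rintro t ⟨ht, s, hs, hst⟩
  filter_upwards [isOpen_Ioo.mem_nhds ht, Ioi_mem_nhds hs.2,
    hf.continuousAt.eventually_lt continuousAt_const hst] with u hu hsu hfu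
  exact ⟨hu, s, ⟨hs.1, hsu⟩, hfu⟩

/-- The rising sun lemma: `f` takes equal values at the ends of a component of its shadow. -/
theorem eq_of_Ioo_shadow {f : ℝ → ℝ} (hf : Continuous f) {a c α β : ℝ}
    (hfc : ∀ s ∈ Icc a c, f s ≤ f c) (hαβ : α < β) (hsub : Ioo α β ⊆ shadow f a c)
    (hα : α ∉ shadow f a c) (hβ : β ∉ shadow f a c) : a ≤ α ∧ β ≤ c ∧ f α = f β := by
  have hI : Icc α β ⊆ Icc a c := by
    have h1 : Ioo α β ⊆ Icc a c := fun t ht => Ioo_subset_Icc_self (hsub ht).1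
    have := closure_mono h1
    rwa [closure_Ioo hαβ.ne, isClosed_Icc.closure_eq] at this
  have haα : a ≤ α := (hI ⟨le_rfl, hαβ.le⟩).1
  have hβc : β ≤ c := (hI ⟨hαβ.le, le_rfl⟩).2
  refine ⟨haα, hβc, le_antisymm ?_ ?_⟩
  · rcases hβc.eq_or_lt with rfl | h
    · exact hfc α ⟨haα, hαβ.le⟩
    · by_contra! h'
      exact hβ ⟨⟨haα.trans_lt hαβ, h⟩, α, ⟨haα, hαβ⟩, h'⟩
  · have key : ∀ t ∈ Ioo α β, f t ≤ f α := by
      intro t ht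
      obtain ⟨⟨hat, htc⟩, s, hs, hst⟩ := hsub ht
      obtain ⟨m, hm, hmax⟩ := isCompact_Icc.exists_isMaxOn (nonempty_Icc.2 hat.le)
        (hf.continuousOn (s := Icc a t))
      have hmS : m ∉ shadow f a c := fun ⟨_, u, hu, hfu⟩ =>
        absurd (hmax ⟨hu.1, hu.2.le.trans hm.2⟩) (not_le.2 hfu)
      have hsm : f s ≤ f m := hmax ⟨hs.1, hs.2.le⟩
      have hmt : m ≠ t := fun h => by subst h; linarith
      have hmα : m ≤ α := by
        by_contra! h
        exact hmS (hsub ⟨h, (hm.2.lt_of_ne hmt).trans ht.2⟩)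
      rcases hmα.eq_or_lt with rfl | h
      · linarith
      · have : f m ≤ f α := by
          by_contra! h'
          exact hα ⟨⟨hm.1.trans_lt h, ht.1.trans htc⟩, m, ⟨hm.1, h⟩, h'⟩
        linarith
    have hcl : IsClosed {t | f t ≤ f α} := isClosed_le hf continuous_const
    have := closure_minimal (s := Ioo α β) key hcl
    rw [closure_Ioo hαβ.ne] at this
    exact this ⟨hαβ.le, le_rfl⟩

/-- If the integral of `H` is nonpositive over each interval at whose ends `f` takes equal values,
then it is nonpositive over the shadow of `f`. -/
theorem setIntegral_shadow_nonpos {f H : ℝ → ℝ} (hf : Continuous f) {a c : ℝ}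
    (hH : IntegrableOn H (Ioo a c)) (hfc : ∀ s ∈ Icc a c, f s ≤ f c)
    (h : ∀ α β, a ≤ α → α < β → β ≤ c → f α = f β → ∫ t in Ioo α β, H t ≤ 0) :
    ∫ t in shadow f a c, H t ≤ 0 := by
  have hS : shadow f a c ⊆ Ioo a c := fun t ht => ht.1
  refine setIntegral_nonpos_of_connectedComponentIn (isOpen_shadow hf a c) (hH.mono_set hS) ?_
  intro x hx
  obtain ⟨α, β, hαβ, hC, hα, hβ⟩ := (isOpen_shadow hf a c).exists_connectedComponentIn_eq_Ioo
    (bddBelow_Ioo.mono hS) (bddAbove_Ioo.mono hS) hx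
  obtain ⟨h1, h2, h3⟩ := eq_of_Ioo_shadow hf hfc hαβ
    (hC ▸ connectedComponentIn_subset _ x) hα hβ
  rw [hC]
  exact h α β h1 hαβ h2 h3

theorem exists_first_hit {f : ℝ → ℝ} (hf : Continuous f) {a b : ℝ} (hab : a ≤ b)
    (hfab : f a ≤ f b) :
    ∃ c ∈ Icc a b, f c = f b ∧ ∀ s ∈ Icc a c, f s ≤ f c := by
  set K := {t | t ∈ Icc a b ∧ f t = f b}
  have hK : IsCompact K :=
    isCompact_Icc.inter_right (isClosed_eq hf continuous_const)
  obtain ⟨c, ⟨hc, hfc⟩, hmin⟩ := hK.exists_isLeast ⟨b, ⟨hab, le_rfl⟩, rfl⟩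
  refine ⟨c, hc, hfc, fun s hs => ?_⟩
  by_contra! h
  obtain ⟨u, hu, hfu⟩ := intermediate_value_Icc hs.1 hf.continuousOn
    (show f b ∈ Icc (f a) (f s) from ⟨hfab, by linarith⟩)
  have hcu := hmin (show u ∈ K from ⟨⟨hu.1, hu.2.trans (hs.2.trans hc.2)⟩, hfu⟩)
  have : s = c := le_antisymm hs.2 (hcu.trans hu.2)
  subst this
  linarith

/-- For a function whose mean over `(a, b)` is at least `l`, there is a set which contains almost
all points of `(a, b)` where the function is below `l`, and which is a union of intervals over
which the function has mean `l`, up to null sets. -/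
theorem exists_set_mean_eq {v : ℝ → ℝ} (hv : Integrable v) {a b l : ℝ} (hab : a < b)
    (hl : l * (b - a) ≤ ∫ t in Ioo a b, v t) :
    ∃ G ⊆ Ioo a b, MeasurableSet G ∧ (∀ᵐ t, t ∈ Ioo a b → t ∉ G → l ≤ v t) ∧
      ∀ H : ℝ → ℝ, IntegrableOn H (Ioo a b) →
        (∀ α β, a ≤ α → α < β → β ≤ b → ∫ t in Ioo α β, v t = l * (β - α) →
          ∫ t in Ioo α β, H t ≤ 0) → ∫ t in G, H t ≤ 0 := by
  set f : ℝ → ℝ := fun t => (∫ s in a..t, v s) - l * (t - a) with hfdef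
  have hint : ∀ x y, IntervalIntegrable v volume x y := fun x y => hv.intervalIntegrable
  have hf : Continuous f :=
    (intervalIntegral.continuous_primitive hint a).sub (by fun_prop)
  have hfd : ∀ α β, α ≤ β → f β - f α = (∫ t in Ioo α β, v t) - l * (β - α) := by
    intro α β h
    have h1 := intervalIntegral.integral_add_adjacent_intervals (hint a α) (hint α β)
    rw [intervalIntegral.integral_of_le h, integral_Ioc_eq_integral_Ioo] at h1
    simp only [hfdef]
    linarith
  obtain ⟨c, hc, hfc, hmax⟩ := exists_first_hit hf hab.le (by linarith [hfd a b hab.le])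
  refine ⟨shadow f a c ∪ Ioo c b, ?_, ?_, ?_, ?_⟩
  · exact union_subset (fun t ht => ⟨ht.1.1, ht.1.2.trans_le hc.2⟩) (Ioo_subset_Ioo_left hc.1)
  · exact (isOpen_shadow hf a c).measurableSet.union measurableSet_Ioo
  · have hne : ∀ᵐ t : ℝ, t ≠ c := by simp [ae_iff, measure_singleton]
    filter_upwards [LocallyIntegrable.ae_hasDerivAt_integral hv.locallyIntegrable, hne]
      with t ht htc htab htG
    rw [mem_union, not_or] at htG
    have htc' : t < c := by
      by_contra! h
      exact htG.2 ⟨h.lt_of_ne htc.symm, htab.2⟩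
    have hd : HasDerivAt f (v t - l) t := by
      have := (ht a).sub (((hasDerivAt_id t).sub_const a).const_mul l)
      rw [mul_one] at this
      exact this
    have hle : ∀ᶠ s in nhdsWithin t (Iio t), 0 ≤ slope f t s := by
      filter_upwards [Ico_mem_nhdsLT htab.1] with s hs
      have : f s ≤ f t := by
        by_contra! h
        exact htG.1 ⟨⟨htab.1, htc'⟩, s, hs, h⟩
      rw [slope_def_field]
      exact div_nonneg_of_nonpos (by linarith) (by linarith [hs.2])
    have := ge_of_tendsto (hasDerivAt_iff_tendsto_slope_left_right.1 hd).1 hle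
    linarith
  · intro H hH h
    have hdisj : Disjoint (shadow f a c) (Ioo c b) :=
      disjoint_left.2 fun t h1 h2 => absurd h1.1.2 (not_lt.2 h2.1.le)
    have hH₁ : IntegrableOn H (Ioo a c) := hH.mono_set (Ioo_subset_Ioo_right hc.2)
    rw [setIntegral_union hdisj measurableSet_Ioo (hH₁.mono_set fun t ht => ht.1)
      (hH.mono_set (Ioo_subset_Ioo_left hc.1))]
    refine add_nonpos (setIntegral_shadow_nonpos hf hH₁ hmax ?_) ?_
    · intro α β h1 h2 h3 h4
      exact h α β h1 h2 (h3.trans hc.2) (by linarith [hfd α β h2.le])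
    · rcases hc.2.eq_or_lt with h1 | h1
      · simp [h1]
      · exact h c b hc.1 h1 le_rfl (by linarith [hfd c b h1.le])

/-- The difference between `u ^ p` and the tangent line at `l` of `u ↦ D * u ^ p`. -/
noncomputable def tangentGap (p D l u : ℝ) : ℝ :=
  u ^ p + D * (p - 1) * l ^ p - p * D * l ^ (p - 1) * u

theorem tangentGap_self {p D l : ℝ} (hl : 0 < l) : tangentGap p D l l = (1 - D) * l ^ p := by
  have : l ^ (p - 1) * l = l ^ p := by
    rw [← Real.rpow_add_one hl.ne']
    ring_nf
  unfold tangentGap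
  linear_combination -p * D * this

theorem tangentGap_mul {p D Q l : ℝ} (hQ : 0 < Q) (hD : Q ^ p = D * (1 + p * (Q - 1)))
    (hl : 0 < l) : tangentGap p D l (Q * l) = 0 := by
  have : l ^ (p - 1) * l = l ^ p := by
    rw [← Real.rpow_add_one hl.ne']
    ring_nf
  unfold tangentGap
  rw [Real.mul_rpow hQ.le hl.le]
  linear_combination -p * D * Q * this + l ^ p * hD

theorem convexOn_tangentGap {p D l : ℝ} (hp : 1 ≤ p) :
    ConvexOn ℝ (Ici 0) (tangentGap p D l) := by
  have h1 : ConvexOn ℝ (Ici (0 : ℝ)) fun u => D * (p - 1) * l ^ p - p * D * l ^ (p - 1) * u := by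
    refine ⟨convex_Ici 0, fun x _ y _ a b _ _ hab => le_of_eq ?_⟩
    simp only [smul_eq_mul]
    linear_combination -(D * (p - 1) * l ^ p) * hab
  refine ((convexOn_rpow hp).add h1).congr fun u _ => ?_
  simp only [Pi.add_apply, tangentGap]
  ring

theorem tangentGap_nonpos {p D Q l u : ℝ} (hp : 1 ≤ p) (hD1 : 1 ≤ D) (hQ : 0 < Q)
    (hD : Q ^ p = D * (1 + p * (Q - 1))) (hl : 0 < l) (h1 : l ≤ u) (h2 : u ≤ Q * l) :
    tangentGap p D l u ≤ 0 := by
  have h := (convexOn_tangentGap (D := D) (l := l) hp).le_max_of_mem_Icc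
    (mem_Ici.2 hl.le) (mem_Ici.2 (by positivity : 0 ≤ Q * l)) ⟨h1, h2⟩
  rw [tangentGap_self hl, tangentGap_mul hQ hD hl] at h
  refine h.trans (max_le ?_ le_rfl)
  exact mul_nonpos_of_nonpos_of_nonneg (by linarith) (by positivity)

theorem tangentGap_nonneg {p D Q l u : ℝ} (hp : 1 ≤ p) (hD1 : 1 < D) (hQ : 1 ≤ Q)
    (hD : Q ^ p = D * (1 + p * (Q - 1))) (hl : 0 < l) (h : Q * l ≤ u) :
    0 ≤ tangentGap p D l u := by
  by_contra! hneg
  have hQ0 : 0 < Q := by linarith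
  have hlQ : l ≤ Q * l := by nlinarith
  have h := (convexOn_tangentGap (D := D) (l := l) hp).le_max_of_mem_Icc
    (mem_Ici.2 hl.le) (mem_Ici.2 (by linarith : 0 ≤ u)) ⟨hlQ, h⟩
  rw [tangentGap_self hl, tangentGap_mul hQ0 hD hl] at h
  refine absurd h (not_le.2 (max_lt ?_ hneg))
  exact mul_neg_of_neg_of_pos (by linarith) (by positivity)

/-- Minus a primitive of `l ↦ l ^ (-r - p - 1) * tangentGap p D l u`. -/
noncomputable def gapPrimitive (p r D l u : ℝ) : ℝ :=
  u ^ p * l ^ (-r - p) / (r + p) + D * (p - 1) * l ^ (-r) / r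
    - p * D * u * l ^ (-r - 1) / (r + 1)

theorem hasDerivAt_gapPrimitive {p r D l u : ℝ} (hp : 0 < p) (hr : 0 < r) (hl : 0 < l) :
    HasDerivAt (fun l => gapPrimitive p r D l u)
      (-(l ^ (-r - p - 1) * tangentGap p D l u)) l := by
  have h (e : ℝ) : HasDerivAt (fun l : ℝ => l ^ e) (e * l ^ (e - 1)) l :=
    Real.hasDerivAt_rpow_const (Or.inl hl.ne')
  have h1 := (((h (-r - p)).const_mul (u ^ p)).div_const (r + p)).add
    (((h (-r)).const_mul (D * (p - 1))).div_const r)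
  have h2 := h1.sub (((h (-r - 1)).const_mul (p * D * u)).div_const (r + 1))
  refine h2.congr_deriv ?_
  have e1 : l ^ (-r - 1) = l ^ (-r - p - 1) * l ^ p := by
    rw [← Real.rpow_add hl]
    ring_nf
  have e2 : l ^ (-r - 1 - 1) = l ^ (-r - p - 1) * l ^ (p - 1) := by
    rw [← Real.rpow_add hl]
    ring_nf
  rw [e1, e2, tangentGap]
  field_simp
  ring

theorem le_gapPrimitive {p r D Q s u : ℝ} (hp : 1 < p) (hr : 0 < r) (hD0 : 0 < D) (hQ : 1 < Q)
    (hD : Q ^ p = D * (1 + p * (Q - 1))) (hrQ : r * (Q - 1) < 1) (hs : 0 < s) (hu : 0 ≤ u)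
    (huQ : u ≤ Q * s) :
    D * (p * (p - 1) / (r * (r + 1) * (r + p))) * (1 - r * (Q - 1)) * s ^ (-r)
      ≤ gapPrimitive p r D s u := by
  obtain ⟨y, rfl⟩ : ∃ y, u = y * s := ⟨u / s, by field_simp⟩
  have hy : 0 ≤ y := nonneg_of_mul_nonneg_left hu hs
  have hyQ : y ≤ Q := le_of_mul_le_mul_right huQ hs
  have e1 : s ^ p * s ^ (-r - p) = s ^ (-r) := by
    rw [← Real.rpow_add hs]
    ring_nf
  have e2 : s * s ^ (-r - 1) = s ^ (-r) := by
    rw [mul_comm, ← Real.rpow_add_one hs.ne']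
    ring_nf
  have e3 : gapPrimitive p r D s (y * s)
      = (y ^ p / (r + p) + D * (p - 1) / r - p * D * y / (r + 1)) * s ^ (-r) := by
    rw [gapPrimitive, Real.mul_rpow hy hs.le]
    linear_combination y ^ p / (r + p) * e1 - p * D * y / (r + 1) * e2
  rw [e3]
  refine mul_le_mul_of_nonneg_right ?_ (by positivity)
  have hQ0 : 0 < Q := by linarith
  have bern : D * (1 + p * (Q - 1)) * (1 + p * (y / Q - 1)) ≤ y ^ p := by
    have h := one_add_mul_self_le_rpow_one_add (s := y / Q - 1)
      (by linarith [div_nonneg hy hQ0.le]) hp.le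
    rw [add_sub_cancel, Real.div_rpow hy hQ0.le, le_div_iff₀ (by positivity), mul_comm, hD] at h
    exact h
  have h1 : D * (1 + p * (Q - 1)) * (1 + p * (y / Q - 1)) / (r + p) ≤ y ^ p / (r + p) :=
    div_le_div_of_nonneg_right bern (by linarith)
  have h2 : D * (p * (p - 1) / (r * (r + 1) * (r + p))) * (1 - r * (Q - 1))
      + D * p * (p - 1) * (Q - y) * (1 - r * (Q - 1)) / (Q * (r + p) * (r + 1))
      = D * (1 + p * (Q - 1)) * (1 + p * (y / Q - 1)) / (r + p) + D * (p - 1) / r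
        - p * D * y / (r + 1) := by
    have : r + p ≠ 0 := by positivity
    field_simp
    ring
  have h3 : 0 ≤ D * p * (p - 1) * (Q - y) * (1 - r * (Q - 1)) / (Q * (r + p) * (r + 1)) := by
    have a1 : 0 ≤ p - 1 := by linarith
    have a2 : 0 ≤ Q - y := by linarith
    have a3 : 0 ≤ 1 - r * (Q - 1) := by linarith
    positivity
  linarith

theorem setIntegral_Ioo_mul_add_sub_mul {f g : ℝ → ℝ} {α β : ℝ} (hαβ : α ≤ β)
    (hf : IntegrableOn f (Ioo α β)) (hg : IntegrableOn g (Ioo α β)) (A B C : ℝ) :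
    ∫ t in Ioo α β, (A * f t + B - C * g t)
      = A * (∫ t in Ioo α β, f t) + B * (β - α) - C * ∫ t in Ioo α β, g t := by
  have hB : IntegrableOn (fun _ : ℝ => B) (Ioo α β) := integrable_const B
  have h1 : IntegrableOn (fun t => A * f t + B) (Ioo α β) := (hf.const_mul A).add hB
  rw [integral_sub h1 (hg.const_mul C), integral_add (hf.const_mul A) hB, integral_const_mul,
    integral_const_mul]
  simp [hαβ, mul_comm]

theorem setIntegral_indicator_tangentGap_nonpos {p D Q a b l : ℝ} {v : ℝ → ℝ} (hp : 1 ≤ p)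
    (hD1 : 1 < D) (hQ : 1 ≤ Q) (hD : Q ^ p = D * (1 + p * (Q - 1))) (hab : a < b) (hl : 0 < l)
    (hvm : Measurable v) (hv : Integrable v) (hvp : IntegrableOn (fun t => v t ^ p) (Ioo a b))
    (hmean : l * (b - a) ≤ ∫ t in Ioo a b, v t)
    (hrh : ∀ α β, a ≤ α → α < β → β ≤ b → ∫ t in Ioo α β, v t = l * (β - α) →
      ∫ t in Ioo α β, v t ^ p ≤ D * l ^ p * (β - α)) :
    ∫ t in Ioo a b, (Iio (Q * l)).indicator (tangentGap p D l) (v t) ≤ 0 := by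
  obtain ⟨G, hGab, hGm, hGl, hG⟩ := exists_set_mean_eq hv hab hmean
  have hint : ∀ α β, a ≤ α → β ≤ b →
      IntegrableOn (fun t => v t ^ p) (Ioo α β) := fun α β h1 h2 =>
    hvp.mono_set (Ioo_subset_Ioo h1 h2)
  have hgap : IntegrableOn (fun t => tangentGap p D l (v t)) (Ioo a b) :=
    (hvp.add (integrable_const _)).sub (hv.integrableOn.const_mul _)
  have hset : MeasurableSet {t | v t < Q * l} := measurableSet_lt hvm measurable_const
  have heq : (fun t => (Iio (Q * l)).indicator (tangentGap p D l) (v t))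
      = {t | v t < Q * l}.indicator fun t => tangentGap p D l (v t) := rfl
  have hmono : ∫ t in Ioo a b, (Iio (Q * l)).indicator (tangentGap p D l) (v t)
      ≤ ∫ t in Ioo a b, G.indicator (fun t => tangentGap p D l (v t)) t := by
    rw [heq]
    refine integral_mono_ae (hgap.indicator hset) (hgap.indicator hGm) ?_
    filter_upwards [ae_restrict_mem measurableSet_Ioo, ae_restrict_of_ae hGl] with t ht hGt
    by_cases h1 : v t < Q * l
    · rw [indicator_of_mem (show t ∈ {t | v t < Q * l} from h1)]
      by_cases h2 : t ∈ G
      · rw [indicator_of_mem h2]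
      · rw [indicator_of_notMem h2]
        exact tangentGap_nonpos hp hD1.le (by linarith) hD hl (hGt ht h2) h1.le
    · rw [indicator_of_notMem (show t ∉ {t | v t < Q * l} from h1)]
      exact indicator_apply_nonneg fun _ => tangentGap_nonneg hp hD1 hQ hD hl (not_lt.1 h1)
  refine hmono.trans ?_
  rw [setIntegral_indicator hGm, inter_eq_right.2 hGab]
  refine hG _ hgap fun α β h1 h2 h3 h4 => ?_
  have hsplit : ∫ t in Ioo α β, tangentGap p D l (v t)
      = (∫ t in Ioo α β, v t ^ p) + D * (p - 1) * l ^ p * (β - α)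
        - p * D * l ^ (p - 1) * ∫ t in Ioo α β, v t := by
    have := setIntegral_Ioo_mul_add_sub_mul h2.le (hint α β h1 h3) hv.integrableOn 1
      (D * (p - 1) * l ^ p) (p * D * l ^ (p - 1))
    simp only [one_mul] at this
    exact this
  have h5 : l ^ (p - 1) * l = l ^ p := by
    rw [← Real.rpow_add_one hl.ne']
    ring_nf
  rw [hsplit, h4]
  have h6 : p * D * l ^ (p - 1) * (l * (β - α)) = p * D * l ^ p * (β - α) := by
    linear_combination p * D * (β - α) * h5
  linarith [hrh α β h1 h2 h3 h4]

theorem integral_rpow_mul_tangentGap {p r D s x u : ℝ} (hp : 0 < p) (hr : 0 < r) (hs : 0 < s)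
    (hx : 0 < x) :
    ∫ l in s..x, l ^ (-r - p - 1) * tangentGap p D l u
      = gapPrimitive p r D s u - gapPrimitive p r D x u := by
  have hpos : ∀ l ∈ uIcc s x, 0 < l := fun l hl => (lt_min hs hx).trans_le hl.1
  have hcont : ContinuousOn (fun l => l ^ (-r - p - 1) * tangentGap p D l u) (uIcc s x) := by
    have h (e : ℝ) : ContinuousOn (fun l : ℝ => l ^ e) (uIcc s x) :=
      continuousOn_id.rpow_const fun l hl => Or.inl (hpos l hl).ne'
    unfold tangentGap
    exact (h _).mul ((continuousOn_const.add (continuousOn_const.mul (h _))).sub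
      ((continuousOn_const.mul (h _)).mul continuousOn_const))
  have := intervalIntegral.integral_eq_sub_of_hasDerivAt
    (fun l hl => hasDerivAt_gapPrimitive (D := D) (u := u) hp hr (hpos l hl))
    hcont.intervalIntegrable.neg
  rw [intervalIntegral.integral_neg] at this
  linarith

theorem le_integral_rpow_mul_indicator_tangentGap {p r D Q ε x u : ℝ} (hp : 1 < p) (hr : 0 < r)
    (hD1 : 1 < D) (hQ : 1 < Q) (hD : Q ^ p = D * (1 + p * (Q - 1))) (hrQ : r * (Q - 1) < 1)
    (hε : 0 < ε) (hεx : ε ≤ x) (hu : 0 ≤ u) :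
    D * (p * (p - 1) / (r * (r + 1) * (r + p))) * (1 - r * (Q - 1)) * max (u / Q) ε ^ (-r)
        - gapPrimitive p r D x u
      ≤ ∫ l in Ioc ε x, l ^ (-r - p - 1) * (Iio (Q * l)).indicator (tangentGap p D l) u := by
  have hQ0 : 0 < Q := by linarith
  set s := max (u / Q) ε with hsdef
  have hs : 0 < s := lt_max_of_lt_right hε
  have huQ : u ≤ Q * s := by
    rw [mul_comm, ← div_le_iff₀ hQ0]
    exact le_max_left _ _
  have h1 := le_gapPrimitive hp hr (by linarith) hQ hD hrQ hs hu huQ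
  have h2 := integral_rpow_mul_tangentGap (D := D) (u := u) (zero_lt_one.trans hp) hr hs
    (hε.trans_le hεx)
  have h3 : ∫ l in Ioc ε x, l ^ (-r - p - 1) * (Iio (Q * l)).indicator (tangentGap p D l) u
      = ∫ l in Ioc s x, l ^ (-r - p - 1) * tangentGap p D l u := by
    have hIoc : Ioc s x = Ioc ε x ∩ Ioi s := by
      ext l
      constructor
      · exact fun h => ⟨⟨(le_max_right _ _).trans_lt h.1, h.2⟩, h.1⟩
      · exact fun h => ⟨h.2, h.1.2⟩
    rw [hIoc, ← setIntegral_indicator measurableSet_Ioi]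
    refine setIntegral_congr_fun measurableSet_Ioc fun l hl => ?_
    by_cases h : s < l
    · have : u < Q * l := huQ.trans_lt (by gcongr)
      simp only [indicator_of_mem (mem_Ioi.2 h), indicator_of_mem (mem_Iio.2 this)]
    · have : ¬ u < Q * l := by
        rw [not_lt, mul_comm, ← le_div_iff₀ hQ0]
        rcases le_max_iff.1 (not_lt.1 h) with h' | h'
        · exact h'
        · exact absurd hl.1 (not_lt.2 h')
      simp only [indicator_of_notMem (notMem_Ioi.2 (not_lt.1 h)),
        indicator_of_notMem (notMem_Iio.2 (not_lt.1 this)), mul_zero]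
  rw [h3]
  rcases le_total s x with h | h
  · rw [← intervalIntegral.integral_of_le h]
    linarith
  · rw [Ioc_eq_empty (not_lt.2 h), setIntegral_empty]
    rw [intervalIntegral.integral_symm, intervalIntegral.integral_of_le h] at h2
    have h4 : 0 ≤ ∫ l in Ioc x s, l ^ (-r - p - 1) * tangentGap p D l u := by
      refine setIntegral_nonneg measurableSet_Ioc fun l hl => ?_
      have hl0 : 0 < l := by linarith [hl.1]
      refine mul_nonneg (by positivity) (tangentGap_nonneg hp.le hD1 hQ.le hD hl0 ?_)
      rcases max_choice (u / Q) ε with h5 | h5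
      · rw [mul_comm, ← le_div_iff₀ hQ0, ← h5]
        exact hl.2
      · linarith [hl.1, hl.2]
    linarith

theorem integrable_rpow_mul_indicator_tangentGap {p r D Q ε x a b : ℝ} {v : ℝ → ℝ} (hp : 1 < p)
    (hr : 0 < r) (hD0 : 0 < D) (hQ0 : 0 < Q) (hε : 0 < ε) (hvm : Measurable v)
    (hv0 : ∀ t, 0 ≤ v t) :
    Integrable (Function.uncurry fun t l : ℝ =>
        l ^ (-r - p - 1) * (Iio (Q * l)).indicator (tangentGap p D l) (v t))
      ((volume.restrict (Ioo a b)).prod (volume.restrict (Ioc ε x))) := by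
  have hmeas : Measurable (Function.uncurry fun t l : ℝ =>
      l ^ (-r - p - 1) * (Iio (Q * l)).indicator (tangentGap p D l) (v t)) := by
    have hset : MeasurableSet {z : ℝ × ℝ | v z.1 < Q * z.2} :=
      measurableSet_lt (by fun_prop) (by fun_prop)
    have h : Measurable fun z : ℝ × ℝ => tangentGap p D z.2 (v z.1) := by
      unfold tangentGap
      fun_prop
    have h' := (show Measurable fun z : ℝ × ℝ => z.2 ^ (-r - p - 1) by fun_prop).mul
      (h.indicator hset)
    exact h'
  refine Integrable.of_bound hmeas.aestronglyMeasurable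
    (ε ^ (-r - p - 1) * ((Q * x) ^ p + D * (p - 1) * x ^ p + p * D * x ^ (p - 1) * (Q * x))) ?_
  rw [Measure.prod_restrict]
  filter_upwards [ae_restrict_mem (measurableSet_Ioo.prod measurableSet_Ioc)] with z hz
  obtain ⟨t, l⟩ := z
  have hl : l ∈ Ioc ε x := hz.2
  have hl0 : 0 < l := hε.trans hl.1
  have hx0 : 0 < x := hl0.trans_le hl.2
  have hp1 : 0 < p - 1 := by linarith
  have hp0 : 0 < p := by linarith
  have hl1 : l ^ p ≤ x ^ p := Real.rpow_le_rpow hl0.le hl.2 hp0.le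
  have hl2 : l ^ (p - 1) ≤ x ^ (p - 1) := Real.rpow_le_rpow hl0.le hl.2 hp1.le
  have hl3 : l ^ (-r - p - 1) ≤ ε ^ (-r - p - 1) :=
    Real.rpow_le_rpow_of_nonpos hε hl.1.le (by linarith)
  simp only [Function.uncurry_apply_pair, norm_mul, Real.norm_eq_abs]
  rw [abs_of_nonneg (by positivity : 0 ≤ l ^ (-r - p - 1))]
  refine mul_le_mul hl3 ?_ (abs_nonneg _) (by positivity)
  by_cases h : v t < Q * l
  · rw [indicator_of_mem (mem_Iio.2 h), tangentGap]
    have hvx : v t ≤ Q * x := h.le.trans (by gcongr; exact hl.2)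
    have hvp : v t ^ p ≤ (Q * x) ^ p := Real.rpow_le_rpow (hv0 t) hvx hp0.le
    have b1 : 0 ≤ v t ^ p := Real.rpow_nonneg (hv0 t) _
    have b2 : D * (p - 1) * l ^ p ≤ D * (p - 1) * x ^ p := by gcongr
    have b3 : 0 ≤ D * (p - 1) * l ^ p := by positivity
    have b4 : p * D * l ^ (p - 1) * v t ≤ p * D * x ^ (p - 1) * (Q * x) :=
      mul_le_mul (by gcongr) hvx (hv0 t) (by positivity)
    have b5 : 0 ≤ p * D * l ^ (p - 1) * v t := mul_nonneg (by positivity) (hv0 t)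
    rw [abs_le]
    constructor <;> linarith
  · rw [indicator_of_notMem (notMem_Iio.2 (not_lt.1 h)), abs_zero]
    positivity

theorem setIntegral_max_rpow_neg_le {p r D Q ε x a b : ℝ} {v : ℝ → ℝ} (hp : 1 < p) (hr : 0 < r)
    (hD1 : 1 < D) (hQ : 1 < Q) (hD : Q ^ p = D * (1 + p * (Q - 1))) (hrQ : r * (Q - 1) < 1)
    (hε : 0 < ε) (hεx : ε ≤ x) (hab : a < b) (hvm : Measurable v) (hv0 : ∀ t, 0 ≤ v t)
    (hv : Integrable v) (hvp : IntegrableOn (fun t => v t ^ p) (Ioo a b))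
    (hvx : ∫ t in Ioo a b, v t = x * (b - a))
    (hrh : ∀ l α β, 0 < l → a ≤ α → α < β → β ≤ b → ∫ t in Ioo α β, v t = l * (β - α) →
      ∫ t in Ioo α β, v t ^ p ≤ D * l ^ p * (β - α)) :
    ∫ t in Ioo a b, max (v t / Q) ε ^ (-r) ≤ (b - a) * (x ^ (-r) / (1 - r * (Q - 1))) := by
  have hx : 0 < x := hε.trans_le hεx
  have hp1 : 0 < p - 1 := by linarith
  have hp0 : 0 < p := by linarith
  set E := p * (p - 1) / (r * (r + 1) * (r + p)) with hE
  have hE0 : 0 < D * E := by positivity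
  have hint := integrable_rpow_mul_indicator_tangentGap (r := r) (x := x) (a := a) (b := b)
    hp hr (by linarith : 0 < D) (by linarith : 0 < Q) hε hvm hv0
  have hswap := integral_integral_swap hint
  have hneg : ∫ l in Ioc ε x, ∫ t in Ioo a b,
      l ^ (-r - p - 1) * (Iio (Q * l)).indicator (tangentGap p D l) (v t) ≤ 0 := by
    refine setIntegral_nonpos measurableSet_Ioc fun l hl => ?_
    have hl0 : 0 < l := hε.trans hl.1
    rw [integral_const_mul]
    refine mul_nonpos_of_nonneg_of_nonpos (by positivity) ?_
    refine setIntegral_indicator_tangentGap_nonpos hp.le hD1 hQ.le hD hab hl0 hvm hv hvp ?_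
      fun α β => hrh l α β hl0
    rw [hvx]
    exact mul_le_mul_of_nonneg_right hl.2 (by linarith)
  have hprim : IntegrableOn (fun t => gapPrimitive p r D x (v t)) (Ioo a b) := by
    unfold gapPrimitive
    exact (((hvp.mul_const _).div_const _).add (integrable_const _)).sub
      (((hv.integrableOn.const_mul _).mul_const _).div_const _)
  have hmax : IntegrableOn (fun t => max (v t / Q) ε ^ (-r)) (Ioo a b) := by
    refine Integrable.of_bound (Measurable.aestronglyMeasurable (by fun_prop)) (ε ^ (-r))
      (Filter.Eventually.of_forall fun t => ?_)
    have h0 : 0 < max (v t / Q) ε := lt_max_of_lt_right hε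
    rw [Real.norm_of_nonneg (by positivity)]
    exact Real.rpow_le_rpow_of_nonpos hε (le_max_right _ _) (by linarith)
  have hlow : D * E * (1 - r * (Q - 1)) * ∫ t in Ioo a b, max (v t / Q) ε ^ (-r)
      ≤ ∫ t in Ioo a b, gapPrimitive p r D x (v t) := by
    have h1 : ∫ t in Ioo a b, (D * E * (1 - r * (Q - 1)) * max (v t / Q) ε ^ (-r)
        - gapPrimitive p r D x (v t)) ≤ ∫ t in Ioo a b, ∫ l in Ioc ε x,
          l ^ (-r - p - 1) * (Iio (Q * l)).indicator (tangentGap p D l) (v t) :=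
      integral_mono ((hmax.const_mul _).sub hprim) hint.integral_prod_left fun t =>
        le_integral_rpow_mul_indicator_tangentGap hp hr hD1 hQ hD hrQ hε hεx (hv0 t)
    rw [integral_sub (hmax.const_mul _) hprim, integral_const_mul, hswap] at h1
    linarith
  have hup : ∫ t in Ioo a b, gapPrimitive p r D x (v t) ≤ D * E * ((b - a) * x ^ (-r)) := by
    have h1 := hrh x a b hx le_rfl hab le_rfl hvx
    have h2 : ∫ t in Ioo a b, gapPrimitive p r D x (v t)
        = (∫ t in Ioo a b, v t ^ p) * x ^ (-r - p) / (r + p)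
          + D * (p - 1) * x ^ (-r) / r * (b - a)
          - p * D * (x * (b - a)) * x ^ (-r - 1) / (r + 1) := by
      have := setIntegral_Ioo_mul_add_sub_mul hab.le hvp hv.integrableOn (x ^ (-r - p) / (r + p))
        (D * (p - 1) * x ^ (-r) / r) (p * D * x ^ (-r - 1) / (r + 1))
      rw [hvx] at this
      calc _ = _ := integral_congr_ae (Filter.Eventually.of_forall fun t => by
            simp only [gapPrimitive]
            ring)
        _ = _ := this
        _ = _ := by ring
    have e1 : x ^ p * x ^ (-r - p) = x ^ (-r) := by
      rw [← Real.rpow_add hx]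
      ring_nf
    have e2 : x * x ^ (-r - 1) = x ^ (-r) := by
      rw [mul_comm, ← Real.rpow_add_one hx.ne']
      ring_nf
    have h3 : (∫ t in Ioo a b, v t ^ p) * x ^ (-r - p) / (r + p)
        ≤ D * x ^ p * (b - a) * x ^ (-r - p) / (r + p) := by gcongr
    have h4 : D * x ^ p * (b - a) * x ^ (-r - p) / (r + p)
        + D * (p - 1) * x ^ (-r) / r * (b - a)
        - p * D * (x * (b - a)) * x ^ (-r - 1) / (r + 1) = D * E * ((b - a) * x ^ (-r)) := by
      have h5 : 1 / (r + p) + (p - 1) / r - p / (r + 1) = E := by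
        rw [hE]
        field_simp
        ring
      linear_combination D * (b - a) / (r + p) * e1 - p * D * (b - a) / (r + 1) * e2
        + D * (b - a) * x ^ (-r) * h5
    linarith
  have h : 0 < 1 - r * (Q - 1) := by linarith
  rw [← mul_div_assoc, le_div_iff₀ h]
  refine le_of_mul_le_mul_left ?_ hE0
  linarith

theorem lintegral_ofReal_rpow_neg_le {p r D Q x a b : ℝ} {v : ℝ → ℝ} (hp : 1 < p) (hr : 0 < r)
    (hD1 : 1 < D) (hQ : 1 < Q) (hD : Q ^ p = D * (1 + p * (Q - 1))) (hrQ : r * (Q - 1) < 1)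
    (hx : 0 < x) (hab : a < b) (hvm : Measurable v) (hv0 : ∀ t, 0 ≤ v t)
    (hv : Integrable v) (hvp : IntegrableOn (fun t => v t ^ p) (Ioo a b))
    (hvx : ∫ t in Ioo a b, v t = x * (b - a))
    (hrh : ∀ l α β, 0 < l → a ≤ α → α < β → β ≤ b → ∫ t in Ioo α β, v t = l * (β - α) →
      ∫ t in Ioo α β, v t ^ p ≤ D * l ^ p * (β - α)) :
    ∫⁻ t in Ioo a b, ENNReal.ofReal (v t) ^ (-r)
      ≤ ENNReal.ofReal ((b - a) * ((Q * x) ^ (-r) / (1 - r * (Q - 1)))) := by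
  have hQ0 : 0 < Q := by linarith
  set ε : ℕ → ℝ := fun n => x * (1 / ((n : ℝ) + 1))
  have hε : ∀ n, 0 < ε n := fun n => by positivity
  have hεx : ∀ n, ε n ≤ x := fun n => by
    refine mul_le_of_le_one_right hx.le ?_
    rw [div_le_one (by positivity)]
    linarith [n.cast_nonneg (α := ℝ)]
  have hε0 : Filter.Tendsto ε Filter.atTop (nhds 0) := by
    have := (tendsto_one_div_add_atTop_nhds_zero_nat (𝕜 := ℝ)).const_mul x
    rwa [mul_zero] at this
  set g : ℕ → ℝ → ℝ := fun n t => Q * max (v t / Q) (ε n)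
  have hgpos : ∀ n t, 0 < g n t := fun n t => mul_pos hQ0 (lt_max_of_lt_right (hε n))
  have hgm : ∀ n, Measurable (g n) := fun n => by fun_prop
  have hbound : ∀ n, ∫⁻ t in Ioo a b, ENNReal.ofReal (g n t) ^ (-r)
      ≤ ENNReal.ofReal ((b - a) * ((Q * x) ^ (-r) / (1 - r * (Q - 1)))) := by
    intro n
    have h1 := setIntegral_max_rpow_neg_le hp hr hD1 hQ hD hrQ (hε n) (hεx n) hab hvm hv0 hv hvp
      hvx hrh
    have hint : IntegrableOn (fun t => g n t ^ (-r)) (Ioo a b) := by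
      refine Integrable.of_bound (Measurable.aestronglyMeasurable (by fun_prop))
        ((Q * ε n) ^ (-r)) (Filter.Eventually.of_forall fun t => ?_)
      rw [Real.norm_of_nonneg (Real.rpow_nonneg (hgpos n t).le _)]
      exact Real.rpow_le_rpow_of_nonpos (mul_pos hQ0 (hε n))
        (mul_le_mul_of_nonneg_left (le_max_right _ _) hQ0.le) (by linarith)
    have h2 : ∫⁻ t in Ioo a b, ENNReal.ofReal (g n t) ^ (-r)
        = ENNReal.ofReal (∫ t in Ioo a b, g n t ^ (-r)) := by
      rw [ofReal_integral_eq_lintegral_ofReal hint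
        (Filter.Eventually.of_forall fun t => Real.rpow_nonneg (hgpos n t).le _)]
      exact lintegral_congr fun t => ENNReal.ofReal_rpow_of_pos (hgpos n t)
    have h3 : ∫ t in Ioo a b, g n t ^ (-r)
        = Q ^ (-r) * ∫ t in Ioo a b, max (v t / Q) (ε n) ^ (-r) := by
      rw [← integral_const_mul]
      exact integral_congr_ae (Filter.Eventually.of_forall fun t =>
        Real.mul_rpow hQ0.le (lt_max_of_lt_right (hε n)).le)
    rw [h2, h3, Real.mul_rpow hQ0.le hx.le]
    refine ENNReal.ofReal_le_ofReal ?_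
    calc _ ≤ Q ^ (-r) * ((b - a) * (x ^ (-r) / (1 - r * (Q - 1)))) := by gcongr
      _ = _ := by ring
  have hlim : ∀ t, Filter.Tendsto (fun n => ENNReal.ofReal (g n t) ^ (-r)) Filter.atTop
      (nhds (ENNReal.ofReal (v t) ^ (-r))) := by
    intro t
    have h1 : Filter.Tendsto (fun n => g n t) Filter.atTop (nhds (v t)) := by
      have := ((tendsto_const_nhds (x := v t / Q)).max hε0).const_mul Q
      rwa [max_eq_left (div_nonneg (hv0 t) hQ0.le), mul_div_cancel₀ _ hQ0.ne'] at this
    exact (ENNReal.continuous_rpow_const.tendsto _).comp (ENNReal.tendsto_ofReal h1)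
  calc ∫⁻ t in Ioo a b, ENNReal.ofReal (v t) ^ (-r)
      = ∫⁻ t in Ioo a b,
          Filter.liminf (fun n => ENNReal.ofReal (g n t) ^ (-r)) Filter.atTop :=
        lintegral_congr fun t => (hlim t).liminf_eq.symm
    _ ≤ Filter.liminf (fun n => ∫⁻ t in Ioo a b, ENNReal.ofReal (g n t) ^ (-r)) Filter.atTop :=
        lintegral_liminf_le fun n => by fun_prop
    _ ≤ _ := Filter.liminf_le_of_le (by isBoundedDefault) fun c hc => by
        obtain ⟨n, hn⟩ := hc.exists
        exact hn.trans (hbound n)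

theorem avgE_mul_ofReal {f : ℝ → ℝ≥0∞} {a b : ℝ} (hab : a < b) :
    avgE f a b * ENNReal.ofReal (b - a) = ∫⁻ t in Ioo a b, f t :=
  ENNReal.div_mul_cancel (ENNReal.ofReal_pos.2 (by linarith)).ne' ENNReal.ofReal_ne_top

theorem statement0 (p δ qs q : ℝ) (hp : 1 < p) (hδ : 1 < δ)
    (hqs1 : 1 < qs) (hqs : ((qs / δ) ^ p - 1) / (qs - 1) = p)
    (hq : qs < q)
    (A B : ℝ) (hAB : A < B) (w : ℝ → ℝ≥0∞) (hw : MemRH p δ A B w) :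
    ∀ a b, A ≤ a → a < b → b ≤ B →
      avgE w a b * (avgE (fun t => w t ^ (1 - q / (q - 1))) a b) ^ (q - 1)
        ≤ ENNReal.ofReal ((1 / qs) * ((q - 1) / (q - qs)) ^ (q - 1)) := by
  intro a b hAa hab hbB
  obtain ⟨hwm, hwint, hrh⟩ := hw
  set r := 1 / (q - 1) with hr_def
  have hq1 : 0 < q - 1 := by linarith
  have hr : 0 < r := by positivity
  have hexp : 1 - q / (q - 1) = -r := by
    rw [hr_def]
    field_simp
    ring
  have hrq : r * (q - 1) = 1 := by rw [hr_def]; field_simp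
  have hrQ : r * (qs - 1) < 1 := by
    rw [← hrq]
    exact mul_lt_mul_of_pos_left (by linarith) hr
  have hδ0 : 0 < δ := by linarith
  have hqs0 : 0 < qs := by linarith
  have hD1 : 1 < δ ^ p := Real.one_lt_rpow hδ (by linarith)
  have hD : qs ^ p = δ ^ p * (1 + p * (qs - 1)) := by
    rw [div_eq_iff (by linarith), Real.div_rpow hqs0.le hδ0.le] at hqs
    rw [← hqs]
    field_simp
    ring
  have hsub : ∀ α β, a ≤ α → β ≤ b → ∫⁻ t in Ioo α β, w t ≠ ⊤ := fun α β h1 h2 =>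
    ne_top_of_le_ne_top hwint
      (lintegral_mono_set (Ioo_subset_Ioo (hAa.trans h1) (h2.trans hbB)))
  have hL : 0 < b - a := by linarith
  have hwa := avgE_mul_ofReal (f := w) hab
  have hfin : avgE w a b ≠ ⊤ :=
    ENNReal.div_ne_top (hsub a b le_rfl le_rfl) (ENNReal.ofReal_pos.2 hL).ne'
  rcases eq_or_ne (avgE w a b) 0 with h0 | h0
  · rw [h0, zero_mul]
    exact zero_le
  set x := (avgE w a b).toReal with hxdef
  have hx : 0 < x := ENNReal.toReal_pos h0 hfin
  have hxa : avgE w a b = ENNReal.ofReal x := (ENNReal.ofReal_toReal hfin).symm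
  have hwtop : ∀ᵐ t ∂volume.restrict (Ioo a b), w t < ⊤ :=
    ae_lt_top hwm (hsub a b le_rfl le_rfl)
  have hwptop : ∫⁻ t in Ioo a b, w t ^ p ≠ ⊤ := by
    rw [← avgE_mul_ofReal hab]
    refine ENNReal.mul_ne_top (ne_top_of_le_ne_top ?_ (hrh a b hAa hab hbB)) ENNReal.ofReal_ne_top
    have hp0 : 0 ≤ p := by linarith
    exact ENNReal.mul_ne_top (ENNReal.rpow_ne_top_of_nonneg hp0 ENNReal.ofReal_ne_top)
      (ENNReal.rpow_ne_top_of_nonneg hp0 hfin)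
  set v : ℝ → ℝ := (Ioo a b).indicator fun t => (w t).toReal with hvdef
  have hvm : Measurable v := hwm.ennreal_toReal.indicator measurableSet_Ioo
  have hv0 : ∀ t, 0 ≤ v t := fun t => indicator_nonneg (fun _ _ => ENNReal.toReal_nonneg) t
  have hveq : ∀ t ∈ Ioo a b, v t = (w t).toReal := fun t ht => indicator_of_mem ht _
  have hv : Integrable v :=
    (integrable_indicator_iff measurableSet_Ioo).2
      (integrable_toReal_of_lintegral_ne_top hwm.aemeasurable (hsub a b le_rfl le_rfl))
  have hvp : IntegrableOn (fun t => v t ^ p) (Ioo a b) := by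
    have h1 : IntegrableOn (fun t => (w t ^ p).toReal) (Ioo a b) :=
      integrable_toReal_of_lintegral_ne_top (hwm.pow_const p).aemeasurable hwptop
    refine h1.congr_fun (fun t ht => ?_) measurableSet_Ioo
    simp only [hveq t ht, ENNReal.toReal_rpow]
  have hvint : ∀ α β, a ≤ α → β ≤ b → ∫ t in Ioo α β, v t = (∫⁻ t in Ioo α β, w t).toReal := by
    intro α β h1 h2
    have hs := Ioo_subset_Ioo h1 h2
    rw [setIntegral_congr_fun measurableSet_Ioo fun t ht => hveq t (hs ht)]
    exact integral_toReal hwm.aemeasurable (ae_restrict_of_ae_restrict_of_subset hs hwtop)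
  have hvpint : ∀ α β, a ≤ α → β ≤ b →
      ∫ t in Ioo α β, v t ^ p = (∫⁻ t in Ioo α β, w t ^ p).toReal := by
    intro α β h1 h2
    have hs := Ioo_subset_Ioo h1 h2
    rw [← integral_toReal (hwm.pow_const p).aemeasurable]
    · refine setIntegral_congr_fun measurableSet_Ioo fun t ht => ?_
      simp only [hveq t (hs ht), ENNReal.toReal_rpow]
    · filter_upwards [ae_restrict_of_ae_restrict_of_subset hs hwtop] with t ht
      exact ENNReal.rpow_lt_top_of_nonneg (by linarith) ht.ne
  have hvx : ∫ t in Ioo a b, v t = x * (b - a) := by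
    rw [hvint a b le_rfl le_rfl, ← hwa, ENNReal.toReal_mul, ENNReal.toReal_ofReal hL.le]
  have hvrh : ∀ l α β, 0 < l → a ≤ α → α < β → β ≤ b → ∫ t in Ioo α β, v t = l * (β - α) →
      ∫ t in Ioo α β, v t ^ p ≤ δ ^ p * l ^ p * (β - α) := by
    intro l α β hl h1 h2 h3 h4
    have hβα : 0 < β - α := by linarith
    have havg : avgE w α β = ENNReal.ofReal l := by
      rw [avgE, ← ENNReal.ofReal_toReal (hsub α β h1 h3), ← hvint α β h1 h3, h4,
        ← ENNReal.ofReal_div_of_pos hβα, mul_div_cancel_right₀ _ hβα.ne']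
    have h5 := hrh α β (hAa.trans h1) h2 (h3.trans hbB)
    rw [havg, ENNReal.ofReal_rpow_of_pos hδ0, ENNReal.ofReal_rpow_of_pos hl,
      ← ENNReal.ofReal_mul (by positivity)] at h5
    rw [hvpint α β h1 h3, ← avgE_mul_ofReal h2, ENNReal.toReal_mul, ENNReal.toReal_ofReal hβα.le]
    refine mul_le_mul_of_nonneg_right ?_ hβα.le
    exact ENNReal.toReal_le_of_le_ofReal (by positivity) h5
  have hmain := lintegral_ofReal_rpow_neg_le hp hr hD1 hqs1 hD hrQ hx hab hvm hv0 hv hvp hvx hvrh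
  have hK : 0 < 1 - r * (qs - 1) := by linarith
  have hweq : ∫⁻ t in Ioo a b, w t ^ (-r) = ∫⁻ t in Ioo a b, ENNReal.ofReal (v t) ^ (-r) := by
    refine lintegral_congr_ae ?_
    filter_upwards [ae_restrict_mem measurableSet_Ioo, hwtop] with t ht htop
    rw [hveq t ht, ENNReal.ofReal_toReal htop.ne]
  have hneg : avgE (fun t => w t ^ (-r)) a b
      ≤ ENNReal.ofReal ((qs * x) ^ (-r) / (1 - r * (qs - 1))) := by
    refine ENNReal.div_le_of_le_mul ?_
    rw [hweq, ← ENNReal.ofReal_mul (by positivity), mul_comm _ (b - a)]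
    exact hmain
  rw [hexp, hxa]
  calc ENNReal.ofReal x * avgE (fun t => w t ^ (-r)) a b ^ (q - 1)
      ≤ ENNReal.ofReal x
        * ENNReal.ofReal ((qs * x) ^ (-r) / (1 - r * (qs - 1))) ^ (q - 1) := by gcongr
    _ = ENNReal.ofReal (x * ((qs * x) ^ (-r) / (1 - r * (qs - 1))) ^ (q - 1)) := by
        rw [ENNReal.ofReal_rpow_of_pos (by positivity), ← ENNReal.ofReal_mul hx.le]
    _ = _ := by
        congr 1
        have e1 : ((qs * x) ^ (-r)) ^ (q - 1) = (qs * x)⁻¹ := by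
          rw [← Real.rpow_mul (by positivity), neg_mul, hrq, Real.rpow_neg_one]
        have e2 : (q - 1) / (q - qs) = 1 / (1 - r * (qs - 1)) := by
          rw [div_eq_div_iff (by linarith) hK.ne']
          linear_combination (1 - qs) * hrq
        rw [e2, Real.div_rpow (by positivity) hK.le, e1, Real.div_rpow zero_le_one hK.le,
          Real.one_rpow]
        field_simp
end

section
/- Let 1 < p < ∞ and δ > 1, and let s⁺ ∈ (0, 1/p) be the unique solution of (1 − p s)^{p−1}/(1 − (p−1) s)^p = δ^{−p} in [0, 1/p]. Then the weight w(t) = t^{s⁺/(1 − p s⁺)} on [0,1] belongs to RH_p^δ([0,1]), and for every q with 1 < q ≤ q*(p,δ) one has ∫_0^1 w(t)^{1−q'} dt = ∞; in particular sup_{J ⊂ [0,1]} ⟨w⟩_J ⟨w^{1−q'}⟩_J^{q−1} = ∞, so no finite A_q constant holds for the whole class RH_p^δ when q ≤ q*(p,δ). -/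
open MeasureTheory Set ENNReal

lemma setLIntegral_Ioo_ofReal_rpow {a b γ : ℝ} (ha : 0 ≤ a) (hab : a ≤ b) (hγ : 0 ≤ γ) :
    ∫⁻ t in Set.Ioo a b, ENNReal.ofReal (t ^ γ) =
      ENNReal.ofReal ((b ^ (γ + 1) - a ^ (γ + 1)) / (γ + 1)) := by
  rw [← integral_rpow (Or.inl (by linarith)), intervalIntegral.integral_of_le hab,
    integral_Ioc_eq_integral_Ioo, ofReal_integral_eq_lintegral_ofReal]
  · have h : IntervalIntegrable (fun t : ℝ => t ^ γ) volume a b :=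
      intervalIntegral.intervalIntegrable_rpow' (by linarith)
    exact ((intervalIntegrable_iff_integrableOn_Ioc_of_le hab).1 h).mono_set Ioo_subset_Ioc_self
  · exact (ae_restrict_mem measurableSet_Ioo).mono fun t ht =>
      Real.rpow_nonneg (ha.trans ht.1.le) _

lemma setLIntegral_Ioo_ofReal_rpow_rpow {a b : ℝ} (ha : 0 ≤ a) (α r : ℝ) :
    ∫⁻ t in Set.Ioo a b, ENNReal.ofReal (t ^ α) ^ r =
      ∫⁻ t in Set.Ioo a b, ENNReal.ofReal (t ^ (α * r)) := by
  refine setLIntegral_congr_fun measurableSet_Ioo fun t ht => ?_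
  have ht0 : 0 < t := ha.trans_lt ht.1
  rw [ENNReal.ofReal_rpow_of_pos (Real.rpow_pos_of_pos ht0 _), ← Real.rpow_mul ht0.le]

/-- Popoviciu's inequality for the pairs `(b, a)` and `(b ^ (p * α + 1), a ^ (p * α + 1))`. -/
lemma rpow_sub_rpow_mul_sub_rpow_le {p α a b : ℝ} (hp : 1 < p) (hα : 0 < α) (ha : 0 ≤ a)
    (hab : a < b) :
    (b ^ (p * α + 1) - a ^ (p * α + 1)) * (b - a) ^ (p - 1) ≤
      (b ^ (α + 1) - a ^ (α + 1)) ^ p := by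
  have hp0 : 0 < p := by linarith
  have hb : 0 < b := ha.trans_lt hab
  have hpα : 0 < p * α := by positivity
  have hba : 0 < b - a := sub_pos.2 hab
  have hD : 0 ≤ b ^ (p * α + 1) - a ^ (p * α + 1) :=
    sub_nonneg.2 (Real.rpow_le_rpow ha hab.le (by linarith))
  set D := b ^ (p * α + 1) - a ^ (p * α + 1) with hDdef
  have hpq := Real.HolderConjugate.conjExponent hp
  have hconj : 1 / p.conjExponent = 1 - 1 / p := by
    have := hpq.inv_add_inv_eq_one
    simp only [one_div]; linarith
  have hpow : ∀ x : ℝ, 0 ≤ x → (x ^ (p * α + 1)) ^ (1 / p) * x ^ (1 - 1 / p) = x ^ (α + 1) := by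
    intro x hx
    have h1p : 1 / p < 1 := by rw [div_lt_one hp0]; exact hp
    have h1p' : 0 < 1 / p := by positivity
    rw [← Real.rpow_mul hx, ← Real.rpow_add_of_nonneg hx (by positivity) (by linarith)]
    congr 1
    field_simp
    ring
  have hroot : ∀ (x r : ℝ), 0 ≤ x → r ≠ 0 → (x ^ (1 / r)) ^ r = x := by
    intro x r hx hr
    rw [← Real.rpow_mul hx, one_div_mul_cancel hr, Real.rpow_one]
  have hA : 0 ≤ a ^ (p * α + 1) := Real.rpow_nonneg ha _
  have hholder := Real.inner_le_Lp_mul_Lq_of_nonneg (Finset.univ : Finset (Fin 2)) hpq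
    (f := ![(a ^ (p * α + 1)) ^ (1 / p), D ^ (1 / p)])
    (g := ![a ^ (1 / p.conjExponent), (b - a) ^ (1 / p.conjExponent)])
    (by intro i _; fin_cases i <;> simp <;> positivity)
    (by intro i _; fin_cases i <;> simp <;> positivity)
  simp only [Fin.sum_univ_two, Matrix.cons_val_zero, Matrix.cons_val_one] at hholder
  rw [hroot _ _ hA hp0.ne', hroot _ _ hD hp0.ne', hroot _ _ ha hpq.symm.ne_zero,
    hroot _ _ hba.le hpq.symm.ne_zero, hconj, hpow a ha,
    show a ^ (p * α + 1) + D = b ^ (p * α + 1) by rw [hDdef]; ring,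
    add_sub_cancel, hpow b hb.le] at hholder
  have hle : D ^ (1 / p) * (b - a) ^ (1 - 1 / p) ≤ b ^ (α + 1) - a ^ (α + 1) := by linarith
  calc D * (b - a) ^ (p - 1) = (D ^ (1 / p) * (b - a) ^ (1 - 1 / p)) ^ p := by
        rw [Real.mul_rpow (by positivity) (by positivity), hroot _ _ hD hp0.ne',
          ← Real.rpow_mul hba.le]
        congr 2
        field_simp
    _ ≤ _ := Real.rpow_le_rpow (by positivity) hle hp0.le

lemma memRH_rpow {p δ α : ℝ} (hp : 1 < p) (hδ : 0 < δ) (hα : 0 < α)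
    (h : (α + 1) ^ p = δ ^ p * (p * α + 1)) :
    MemRH p δ 0 1 (fun t => ENNReal.ofReal (t ^ α)) := by
  refine ⟨by fun_prop, ?_, fun a b ha hab _ => ?_⟩
  · rw [setLIntegral_Ioo_ofReal_rpow le_rfl zero_le_one hα.le]
    exact ENNReal.ofReal_ne_top
  have hpα : 0 < p * α := mul_pos (by linarith) hα
  have hba : 0 < b - a := sub_pos.2 hab
  have hE : 0 ≤ b ^ (α + 1) - a ^ (α + 1) :=
    sub_nonneg.2 (Real.rpow_le_rpow ha hab.le (by linarith))
  simp only [avgE]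
  rw [setLIntegral_Ioo_ofReal_rpow_rpow ha, mul_comm α p,
    setLIntegral_Ioo_ofReal_rpow ha hab.le hpα.le, setLIntegral_Ioo_ofReal_rpow ha hab.le hα.le,
    ← ENNReal.ofReal_div_of_pos hba, ← ENNReal.ofReal_div_of_pos hba,
    ENNReal.ofReal_rpow_of_pos hδ, ENNReal.ofReal_rpow_of_nonneg (by positivity) (by linarith),
    ← ENNReal.ofReal_mul (by positivity)]
  refine ENNReal.ofReal_le_ofReal ?_
  have key := rpow_sub_rpow_mul_sub_rpow_le hp hα ha hab
  rw [Real.div_rpow (by positivity) hba.le, Real.div_rpow hE (by positivity), h,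
    show (b - a) ^ p = (b - a) ^ (p - 1) * (b - a) by
      rw [← Real.rpow_add_one hba.ne', sub_add_cancel]]
  have hδp : 0 < δ ^ p := Real.rpow_pos_of_pos hδ _
  have hX : 0 < (b - a) ^ (p - 1) := Real.rpow_pos_of_pos hba _
  calc _ = (b ^ (p * α + 1) - a ^ (p * α + 1)) * (b - a) ^ (p - 1) /
        ((p * α + 1) * ((b - a) ^ (p - 1) * (b - a))) := by field_simp
    _ ≤ (b ^ (α + 1) - a ^ (α + 1)) ^ p / ((p * α + 1) * ((b - a) ^ (p - 1) * (b - a))) := by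
        gcongr
    _ = _ := by field_simp

/-- On `(1, ∞)` a root of `x ^ p = δ ^ p * (1 + p * (x - 1))` is at most any other root. -/
lemma le_of_rpow_eq_mul {p δ x y : ℝ} (hp : 1 < p) (hδ : 1 < δ) (hx : 1 < x)
    (hxe : x ^ p = δ ^ p * (1 + p * (x - 1))) (hye : y ^ p = δ ^ p * (1 + p * (y - 1))) :
    y ≤ x := by
  by_contra! hxy
  have hy : 1 < y := hx.trans hxy
  have hδp : 1 < δ ^ p := Real.one_lt_rpow hδ (by linarith)
  have hy1 : 0 < y - 1 := by linarith
  have hc := (convexOn_rpow hp.le).2 (show (1 : ℝ) ∈ Set.Ici 0 by simp)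
    (show y ∈ Set.Ici 0 by simp; linarith)
    (show 0 ≤ (y - x) / (y - 1) from div_nonneg (by linarith) hy1.le)
    (show 0 ≤ (x - 1) / (y - 1) from div_nonneg (by linarith) hy1.le)
    (by field_simp; ring)
  simp only [smul_eq_mul, Real.one_rpow] at hc
  rw [show (y - x) / (y - 1) * 1 + (x - 1) / (y - 1) * y = x by field_simp; ring, hxe, hye] at hc
  have hid : δ ^ p * (1 + p * (x - 1)) = (y - x) / (y - 1) * δ ^ p +
      (x - 1) / (y - 1) * (δ ^ p * (1 + p * (y - 1))) := by field_simp; ring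
  have : 0 < (y - x) / (y - 1) := div_pos (by linarith) hy1
  nlinarith

lemma setLIntegral_Ioo_rpow_rpow_eq_top {α q : ℝ} (hq : 1 < q) (hqα : q ≤ α + 1) :
    ∫⁻ t in Set.Ioo (0 : ℝ) 1, ENNReal.ofReal (t ^ α) ^ (1 - q / (q - 1)) = ⊤ := by
  rw [setLIntegral_Ioo_ofReal_rpow_rpow le_rfl]
  by_contra hne
  have hq1 : 0 < q - 1 := by linarith
  rw [← ne_eq, lintegral_ofReal_ne_top_iff_integrable (by fun_prop)
    ((ae_restrict_mem measurableSet_Ioo).mono fun t ht => Real.rpow_nonneg ht.1.le _)] at hne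
  have hlt := (intervalIntegral.integrableOn_Ioo_rpow_iff zero_lt_one).1 hne
  rw [show α * (1 - q / (q - 1)) = -(α / (q - 1)) by field_simp; ring, neg_lt_neg_iff,
    div_lt_one hq1] at hlt
  linarith

theorem statement2 (p δ s qs : ℝ) (hp : 1 < p) (hδ : 1 < δ)
    (hs0 : 0 < s) (hs1 : s < 1 / p)
    (hs : (1 - p * s) ^ (p - 1) / (1 - (p - 1) * s) ^ p = δ ^ (-p))
    (hqs1 : 1 < qs) (hqs : ((qs / δ) ^ p - 1) / (qs - 1) = p) :
    MemRH p δ 0 1 (fun t => ENNReal.ofReal (t ^ (s / (1 - p * s)))) ∧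
    ∀ q : ℝ, 1 < q → q ≤ qs →
      (∫⁻ t in Set.Ioo (0:ℝ) 1,
          (ENNReal.ofReal (t ^ (s / (1 - p * s)))) ^ (1 - q / (q - 1))) = ⊤ ∧
      sSup { y : ℝ≥0∞ | ∃ a b : ℝ, 0 ≤ a ∧ a < b ∧ b ≤ 1 ∧
          y = avgE (fun t => ENNReal.ofReal (t ^ (s / (1 - p * s)))) a b *
              (avgE (fun t => (ENNReal.ofReal (t ^ (s / (1 - p * s)))) ^ (1 - q / (q - 1)))
                a b) ^ (q - 1) } = ⊤ := by
  have hp0 : 0 < p := by linarith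
  have hδ0 : 0 < δ := by linarith
  have h1 : 0 < 1 - p * s := by
    rw [lt_div_iff₀ hp0] at hs1; linarith
  have h2 : 0 < 1 - (p - 1) * s := by linarith
  have hδp : 0 < δ ^ p := Real.rpow_pos_of_pos hδ0 _
  set α := s / (1 - p * s) with hα
  have hα0 : 0 < α := div_pos hs0 h1
  have hα1 : α + 1 = (1 - (p - 1) * s) / (1 - p * s) := by
    rw [hα, eq_div_iff h1.ne', add_mul, div_mul_cancel₀ _ h1.ne']; ring
  have hpα1 : p * α + 1 = 1 / (1 - p * s) := by
    rw [hα, eq_div_iff h1.ne', add_mul, mul_assoc, div_mul_cancel₀ _ h1.ne']; ring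
  have hroot : (α + 1) ^ p = δ ^ p * (p * α + 1) := by
    rw [Real.rpow_sub_one h1.ne', Real.rpow_neg hδ0.le] at hs
    have hX : 0 < (1 - p * s) ^ p := Real.rpow_pos_of_pos h1 _
    have hY : 0 < (1 - (p - 1) * s) ^ p := Real.rpow_pos_of_pos h2 _
    rw [hα1, hpα1, Real.div_rpow h2.le h1.le, mul_one_div, div_eq_div_iff hX.ne' h1.ne']
    rw [div_div, inv_eq_one_div, div_eq_div_iff (by positivity) hδp.ne'] at hs
    linarith
  have hqsα : qs ≤ α + 1 := by
    refine le_of_rpow_eq_mul hp hδ (by linarith) (by rw [hroot]; ring) ?_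
    rw [div_eq_iff (by linarith), Real.div_rpow (by linarith) hδ0.le] at hqs
    rw [← hqs]
    field_simp
    ring
  refine ⟨memRH_rpow hp hδ0 hα0 hroot, fun q hq1 hq => ?_⟩
  have htop := setLIntegral_Ioo_rpow_rpow_eq_top hq1 (hq.trans hqsα)
  refine ⟨htop, top_unique (le_sSup ⟨0, 1, le_rfl, zero_lt_one, le_rfl, ?_⟩)⟩
  simp only [avgE]
  rw [htop, setLIntegral_Ioo_ofReal_rpow le_rfl zero_le_one hα0.le]
  have hα1' : 0 < α + 1 := by linarith
  simp [ENNReal.top_rpow_of_pos (sub_pos.2 hq1), Real.zero_rpow hα1'.ne', ENNReal.mul_top, hα1']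
end

section
/- Let 1 < p < ∞ and δ > 1, and let q*(p,δ) be the unique solution x > 1 of ((x/δ)^p − 1)/(x − 1) = p. Then every weight w ∈ RH_p^δ(I) on a bounded interval I ⊂ ℝ satisfies, for every subinterval J ⊂ I, ⟨w⟩_J · exp(−⟨log w⟩_J) ≤ (1/q*(p,δ)) · exp(q*(p,δ) − 1), and this constant is the best possible. -/
open MeasureTheory Set

/-- The average `⟨f⟩_{(a,b)}` of a real-valued function over an interval. -/
noncomputable def avgR (f : ℝ → ℝ) (a b : ℝ) : ℝ :=
  (∫ t in Set.Ioo a b, f t) / (b - a)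

/-- `w ∈ RH_p^δ([A,B])`: a nonnegative measurable weight, with `w` and `w^p`
integrable, whose `p`-reverse-Hölder ratio is at most `δ` on every subinterval. -/
def MemRHreal (p δ A B : ℝ) (w : ℝ → ℝ) : Prop :=
  Measurable w ∧ (∀ t, 0 ≤ w t) ∧
    IntegrableOn w (Set.Ioo A B) ∧ IntegrableOn (fun t => w t ^ p) (Set.Ioo A B) ∧
    ∀ a b, A ≤ a → a < b → b ≤ B →
      avgR (fun t => w t ^ p) a b ≤ δ ^ p * (avgR w a b) ^ p

/-- **Rising sun decomposition.** -/
theorem exists_rising_sun {Φ : ℝ → ℝ} (hΦ : Continuous Φ) {a b : ℝ} (hab : a < b)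
    (hle : Φ a ≤ Φ b) :
    ∃ M : ℝ → ℝ, Continuous M ∧ MonotoneOn M (Icc a b) ∧
      (∀ y, (∃ t ∈ Icc a b, M t = y) → ∃ c d, a ≤ c ∧ c ≤ d ∧ d ≤ b ∧ Φ c = Φ d ∧
        {t | t ∈ Icc a b ∧ M t = y} = Icc c d) ∧
      ∀ t ∈ Icc a b, (∀ s ∈ Ico a t, M s ≠ M t) → ∀ s ∈ Ico a t, Φ s ≤ Φ t := by
  set m : ℝ → ℝ := fun t => sSup ((fun s => Φ (min s t)) '' Icc a b) with hm
  have hmc : Continuous m :=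
    isCompact_Icc.continuous_sSup (f := fun t s => Φ (min s t)) (by
      simp only [Function.HasUncurry.uncurry, id]; fun_prop)
  have hcpt : ∀ t, IsCompact ((fun s => Φ (min s t)) '' Icc a b) := fun t =>
    isCompact_Icc.image (by fun_prop)
  have hne : ∀ t, ((fun s => Φ (min s t)) '' Icc a b).Nonempty := fun t =>
    (nonempty_Icc.2 hab.le).image _
  have hub : ∀ t ≤ b, ∀ s, a ≤ s → s ≤ t → Φ s ≤ m t := fun t ht s has hst =>
    le_csSup (hcpt t).bddAbove ⟨s, ⟨has, hst.trans ht⟩, by simp [hst]⟩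
  have hat : ∀ t, a ≤ t → ∃ s, a ≤ s ∧ s ≤ t ∧ Φ s = m t := by
    intro t hat
    obtain ⟨s, hs, h⟩ := (hcpt t).sSup_mem (hne t)
    exact ⟨min s t, le_min hs.1 hat, min_le_right _ _, h⟩
  have hmm : ∀ s t, a ≤ s → s ≤ t → t ≤ b → m s ≤ m t := by
    intro s t has hst htb
    obtain ⟨r, har, hrs, hr⟩ := hat s has
    exact hr ▸ hub t htb r har (hrs.trans hst)
  have hmon : MonotoneOn (fun t => min (m t) (Φ b)) (Icc a b) := fun s hs t ht hst =>
    min_le_min_right _ (hmm s t hs.1 hst ht.2)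
  have hma : m a = Φ a := by
    obtain ⟨r, har, hrs, hr⟩ := hat a le_rfl
    rw [← hr, le_antisymm hrs har]
  have hstep : ∀ t ∈ Icc a b, (∀ s ∈ Ico a t, m s ≠ m t) → m t = Φ t := by
    intro t ht h
    obtain ⟨r, har, hrt, hr⟩ := hat t ht.1
    rcases hrt.lt_or_eq with hlt | rfl
    · exact absurd (le_antisymm (hmm r t har hlt.le ht.2) (hr ▸ hub r (hlt.le.trans ht.2) r har le_rfl))
        (h r ⟨har, hlt⟩)
    · exact hr.symm
  refine ⟨fun t => min (m t) (Φ b), hmc.min continuous_const, hmon, ?_, ?_⟩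
  · rintro y ⟨t₀, ht₀, hy⟩
    set S : Set ℝ := {t | t ∈ Icc a b ∧ min (m t) (Φ b) = y} with hS
    have hSc : IsCompact S := by
      have : S = Icc a b ∩ (fun t => min (m t) (Φ b)) ⁻¹' {y} := rfl
      rw [this]
      exact isCompact_Icc.inter_right (isClosed_singleton.preimage (hmc.min continuous_const))
    have hSn : S.Nonempty := ⟨t₀, ht₀, hy⟩
    have hc := hSc.sInf_mem hSn
    have hd := hSc.sSup_mem hSn
    have hcl : ∀ t ∈ S, sInf S ≤ t := fun t ht => csInf_le hSc.bddBelow ht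
    have hdl : ∀ t ∈ S, t ≤ sSup S := fun t ht => le_csSup hSc.bddAbove ht
    generalize sInf S = c at *
    generalize sSup S = d at *
    have hcd : c ≤ d := hcl d hd
    have hSI : S = Icc c d := by
      ext t
      refine ⟨fun h => ⟨hcl t h, hdl t h⟩, fun h => ?_⟩
      have ht : t ∈ Icc a b := ⟨hc.1.1.trans h.1, h.2.trans hd.1.2⟩
      refine ⟨ht, le_antisymm ?_ ?_⟩
      · rw [← hd.2]; exact hmon ht hd.1 h.2
      · rw [← hc.2]; exact hmon hc.1 ht h.1
    refine ⟨c, d, hc.1.1, hcd, hd.1.2, ?_, hSI⟩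
    have hyb : y ≤ Φ b := hc.2 ▸ min_le_right _ _
    have h1 : Φ c = y := by
      have hmcc : m c = Φ c := by
        apply hstep c hc.1
        intro s hs h
        have : s ∈ S := ⟨⟨hs.1, hs.2.le.trans hc.1.2⟩, by rw [h]; exact hc.2⟩
        exact absurd (hcl s this) (not_le.2 hs.2)
      rcases hc.1.1.eq_or_lt with rfl | hac
      · have := hc.2
        rw [hma, min_eq_left hle] at this; exact this
      · have hlt : ∀ s ∈ Ioo a c, Φ s ≤ y := by
          intro s hs
          have hsI : s ∈ Icc a b := ⟨hs.1.le, hs.2.le.trans hc.1.2⟩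
          have h2 : min (m s) (Φ b) ≤ y := hc.2 ▸ hmon hsI hc.1 hs.2.le
          have h3 : min (m s) (Φ b) ≠ y := fun h => absurd (hcl s ⟨hsI, h⟩) (not_le.2 hs.2)
          have h4 : m s < y := by
            rcases min_lt_iff.1 (lt_of_le_of_ne h2 h3) with h | h
            · exact h
            · exact absurd hyb (not_le.2 h)
          exact (hub s hsI.2 s hsI.1 le_rfl).trans h4.le
        have hle' : Φ c ≤ y := by
          have : Icc a c ⊆ {s | Φ s ≤ y} := by
            rw [← closure_Ioo hac.ne]
            exact closure_minimal hlt (isClosed_le hΦ continuous_const)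
          exact this ⟨hac.le, le_rfl⟩
        refine le_antisymm hle' ?_
        have := hc.2
        rw [hmcc] at this
        exact this ▸ min_le_left _ _
    have h2 : Φ d = y := by
      rcases hyb.eq_or_lt with rfl | hyb'
      · have : b ∈ S := ⟨⟨hab.le, le_rfl⟩, min_eq_right (hub b le_rfl b hab.le le_rfl)⟩
        rw [le_antisymm hd.1.2 (hdl b this)]
      · have hmd : m d = y := by
          rcases min_choice (m d) (Φ b) with h | h
          · rw [← h]; exact hd.2
          · exact absurd (h ▸ hd.2) hyb'.ne'
        have hdb : d < b := by
          refine lt_of_le_of_ne hd.1.2 ?_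
          rintro rfl
          have := hub d le_rfl d hab.le le_rfl
          linarith
        refine le_antisymm (hmd ▸ hub d hd.1.2 d hd.1.1 le_rfl) ?_
        by_contra! hlt
        have hev : ∀ᶠ t in nhdsWithin d (Ioi d), Φ t < y :=
          (hΦ.tendsto d).mono_left nhdsWithin_le_nhds |>.eventually (gt_mem_nhds hlt)
        obtain ⟨u, hu, hu'⟩ := (mem_nhdsGT_iff_exists_Ioo_subset' hdb).1 hev
        obtain ⟨t, hdt, htu⟩ := exists_between (lt_min hu hdb)
        have htb : t ≤ b := htu.le.trans (min_le_right _ _)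
        have hmt : m t ≤ y := by
          obtain ⟨r, har, hrt, hr⟩ := hat t (hd.1.1.trans hdt.le)
          rw [← hr]
          rcases le_or_gt r d with h | h
          · exact hmd ▸ hub d hd.1.2 r har h
          · exact (hu' ⟨h, hrt.trans_lt (htu.trans_le (min_le_left _ _))⟩ : Φ r < y).le
        have hmt' : m t = y := le_antisymm hmt (hmd ▸ hmm d t hd.1.1 hdt.le htb)
        have : t ∈ S := ⟨⟨hd.1.1.trans hdt.le, htb⟩, by rw [hmt', min_eq_left hyb]⟩
        exact absurd (hdl t this) (not_le.2 hdt)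
    rw [h1, h2]
  · intro t ht h s hs
    have := hstep t ht (fun r hr hrt => h r hr (by simp only [hrt]))
    rw [← this]
    exact hub t ht.2 s hs.1 hs.2.le

theorem exists_balanced_set {f g : ℝ → ℝ} {a b : ℝ} (hab : a < b)
    (hf : IntegrableOn f (Ioo a b)) (hg : IntegrableOn g (Ioo a b))
    (h0 : 0 ≤ ∫ t in Ioo a b, f t)
    (H : ∀ c d, a ≤ c → c < d → d ≤ b → ∫ t in Ioo c d, f t = 0 → 0 ≤ ∫ t in Ioo c d, g t) :
    ∃ G, MeasurableSet G ∧ 0 ≤ ∫ t in G ∩ Ioo a b, g t ∧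
      ∀ᵐ t, t ∈ Ioo a b → t ∉ G → 0 ≤ f t := by
  set F : ℝ → ℝ := (Ioo a b).indicator f with hF
  have hFi : Integrable F := (integrable_indicator_iff measurableSet_Ioo).2 hf
  set Φ : ℝ → ℝ := fun t => ∫ s in a..t, F s with hΦ
  have hΦc : Continuous Φ := hFi.continuous_primitive a
  have hsub : ∀ c d, a ≤ c → c ≤ d → d ≤ b → Φ d - Φ c = ∫ t in Ioo c d, f t := by
    intro c d hac hcd hdb
    rw [hΦ]
    simp only
    rw [intervalIntegral.integral_interval_sub_left hFi.intervalIntegrable hFi.intervalIntegrable,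
      intervalIntegral.integral_of_le hcd, integral_Ioc_eq_integral_Ioo]
    exact setIntegral_congr_fun measurableSet_Ioo fun t ht =>
      indicator_of_mem (Ioo_subset_Ioo hac hdb ht) f
  have hle : Φ a ≤ Φ b := by
    have := hsub a b le_rfl hab.le le_rfl
    linarith
  obtain ⟨M, hMc, hMm, hfib, htriv⟩ := exists_rising_sun hΦc hab hle
  set Y : Set ℝ := {y | 0 < (volume.restrict (Ioo a b)) {t | M t = y}} with hY
  have hYc : Y.Countable := Measure.countable_meas_level_set_pos hMc.measurable
  refine ⟨M ⁻¹' Y, hMc.measurable hYc.measurableSet, ?_, ?_⟩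
  · have hun : M ⁻¹' Y ∩ Ioo a b = ⋃ y : Y, {t | M t = y} ∩ Ioo a b := by
      ext t; simp only [Y, mem_inter_iff, mem_preimage, mem_ofPred_eq, mem_iUnion, Subtype.exists]; grind
    have : Countable Y := hYc.to_subtype
    rw [hun]
    refine (hasSum_integral_iUnion (fun y => ?_) ?_ ?_).nonneg fun y => ?_
    · exact (hMc.measurable (measurableSet_singleton _)).inter measurableSet_Ioo
    · intro y z hyz
      rw [Function.onFun, Set.disjoint_left]
      rintro t ⟨h1, -⟩ ⟨h2, -⟩
      exact hyz (Subtype.ext (h1.symm.trans h2))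
    · exact hg.mono_set (iUnion_subset fun _ => inter_subset_right)
    · obtain ⟨y, hy⟩ := y
      have hm : MeasurableSet {t | M t = y} := hMc.measurable (measurableSet_singleton y)
      have hy' : 0 < volume ({t | M t = y} ∩ Ioo a b) := by
        rw [← Measure.restrict_apply hm]; exact hy
      obtain ⟨t, ht⟩ := nonempty_of_measure_ne_zero hy'.ne'
      obtain ⟨c, d, hac, hcd, hdb, hcd', hfy⟩ := hfib y ⟨t, Ioo_subset_Icc_self ht.2, ht.1⟩
      have hset : ({t | M t = y} ∩ Ioo a b : Set ℝ) =ᵐ[volume] Ioo c d := by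
        have h1 : ({t | M t = y} ∩ Ioo a b : Set ℝ) =ᵐ[volume] ({t | M t = y} ∩ Icc a b : Set ℝ) :=
          (ae_eq_refl _).inter Ioo_ae_eq_Icc
        have h2 : ({t | M t = y} ∩ Icc a b : Set ℝ) = Icc c d := by
          rw [← hfy]; ext; simp [and_comm]
        rw [h2] at h1
        exact h1.trans Ioo_ae_eq_Icc.symm
      rw [setIntegral_congr_set hset]
      rcases hcd.eq_or_lt with rfl | hlt
      · simp
      · exact H c d hac hlt hdb (by rw [← hsub c d hac hcd hdb, hcd', sub_self])
  · filter_upwards [LocallyIntegrable.ae_hasDerivAt_integral hFi.locallyIntegrable] with t hder ht htG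
    have hd : HasDerivAt Φ (f t) t := by
      have := hder a
      rwa [hF, indicator_of_mem ht] at this
    have hmono : ∀ s ∈ Ico a t, Φ s ≤ Φ t := by
      refine htriv t (Ioo_subset_Icc_self ht) fun s hs hst => htG ?_
      have hsubs : Ioo s t ⊆ {r | M r = M t} ∩ Ioo a b := by
        intro r hr
        have hr' : r ∈ Ioo a b := ⟨hs.1.trans_lt hr.1, hr.2.trans ht.2⟩
        refine ⟨le_antisymm ?_ ?_, hr'⟩
        · exact hMm (Ioo_subset_Icc_self hr') (Ioo_subset_Icc_self ht) hr.2.le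
        · rw [← hst]
          exact hMm ⟨hs.1, hs.2.le.trans ht.2.le⟩ (Ioo_subset_Icc_self hr') hr.1.le
      change 0 < (volume.restrict (Ioo a b)) {r | M r = M t}
      have hm : MeasurableSet {r | M r = M t} := hMc.measurable (measurableSet_singleton _)
      rw [Measure.restrict_apply hm]
      refine lt_of_lt_of_le ?_ (measure_mono hsubs)
      simp [hs.2]
    have hs := (hasDerivWithinAt_iff_tendsto_slope' (s := Iio t) (by simp)).1 hd.hasDerivWithinAt
    refine ge_of_tendsto hs ?_
    filter_upwards [Ioo_mem_nhdsLT ht.1] with s hs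
    rw [slope_def_field]
    exact div_nonneg_of_nonpos (by linarith [hmono s ⟨hs.1.le, hs.2⟩]) (by linarith [hs.2])

theorem rpow_le_tangent {p D q r : ℝ} (hp : 1 < p) (hD : 1 < D) (hq : 1 < q)
    (hqD : q ^ p = D * (1 + p * (q - 1))) (h1 : 1 ≤ r) (hr : r ≤ q) :
    r ^ p ≤ D * (1 + p * (r - 1)) := by
  have hq0 : 0 < q - 1 := by linarith
  have hc := (convexOn_rpow hp.le).2 (show (1 : ℝ) ∈ Ici 0 from mem_Ici.2 zero_le_one)
    (show q ∈ Ici 0 from zero_le_one.trans hq.le)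
    (show 0 ≤ (q - r) / (q - 1) from div_nonneg (by linarith) hq0.le)
    (show 0 ≤ (r - 1) / (q - 1) from div_nonneg (by linarith) hq0.le) (by field_simp; ring)
  have e : ((q - r) / (q - 1)) • (1 : ℝ) + ((r - 1) / (q - 1)) • q = r := by
    simp only [smul_eq_mul]; field_simp; ring
  rw [e] at hc
  simp only [smul_eq_mul, Real.one_rpow, mul_one, hqD] at hc
  have h2 : (q - r) / (q - 1) ≤ D * ((q - r) / (q - 1)) :=
    le_mul_of_one_le_left (div_nonneg (by linarith) hq0.le) hD.le
  have h3 : D * ((q - r) / (q - 1)) + (r - 1) / (q - 1) * (D * (1 + p * (q - 1)))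
      = D * (1 + p * (r - 1)) := by field_simp; ring
  linarith

theorem tangent_le_rpow {p D q r : ℝ} (hp : 1 < p) (hD : 1 < D) (hq : 1 < q)
    (hqD : q ^ p = D * (1 + p * (q - 1))) (hr : q ≤ r) :
    D * (1 + p * (r - 1)) ≤ r ^ p := by
  by_contra! hlt
  have hr0 : 0 < r - 1 := by linarith
  have hc := (convexOn_rpow hp.le).2 (show (1 : ℝ) ∈ Ici 0 from mem_Ici.2 zero_le_one)
    (show r ∈ Ici 0 from zero_le_one.trans (hq.le.trans hr))
    (show 0 ≤ (r - q) / (r - 1) from div_nonneg (by linarith) hr0.le)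
    (show 0 ≤ (q - 1) / (r - 1) from div_nonneg (by linarith) hr0.le) (by field_simp; ring)
  have e : ((r - q) / (r - 1)) • (1 : ℝ) + ((q - 1) / (r - 1)) • r = q := by
    simp only [smul_eq_mul]; field_simp; ring
  rw [e] at hc
  simp only [smul_eq_mul, Real.one_rpow, mul_one, hqD] at hc
  have h2 : (r - q) / (r - 1) ≤ D * ((r - q) / (r - 1)) :=
    le_mul_of_one_le_left (div_nonneg (by linarith) hr0.le) hD.le
  have h4 : (q - 1) / (r - 1) * r ^ p < (q - 1) / (r - 1) * (D * (1 + p * (r - 1))) :=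
    mul_lt_mul_of_pos_left hlt (div_pos (by linarith) hr0)
  have h3 : D * ((r - q) / (r - 1)) + (q - 1) / (r - 1) * (D * (1 + p * (r - 1)))
      = D * (1 + p * (q - 1)) := by field_simp; ring
  linarith

/-- The kernel whose integral against a reverse Hölder weight is nonnegative at every level. -/
noncomputable def levelKernel (p D q x v : ℝ) : ℝ :=
  if v ≤ q * x then (D * (1 + p * (v / x - 1)) - (v / x) ^ p) / x else 0

/-- The level-set form of the reverse Hölder condition. -/
theorem integral_level_nonneg {p D q a b x : ℝ} {w : ℝ → ℝ} (hp : 1 < p) (hD : 1 < D) (hq : 1 < q)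
    (hqD : q ^ p = D * (1 + p * (q - 1))) (hab : a < b) (hwm : Measurable w) (hw0 : ∀ t, 0 ≤ w t)
    (hw : IntegrableOn w (Ioo a b)) (hwp : IntegrableOn (fun t => w t ^ p) (Ioo a b))
    (hRH : ∀ c d, a ≤ c → c < d → d ≤ b →
      avgR (fun t => w t ^ p) c d ≤ D * avgR w c d ^ p)
    (hx : 0 < x) (hxX : x ≤ avgR w a b) :
    IntegrableOn (fun t => levelKernel p D q x (w t)) (Ioo a b) ∧
    0 ≤ ∫ t in Ioo a b, levelKernel p D q x (w t) := by
  set g : ℝ → ℝ := fun t => (D * (1 + p * (w t / x - 1)) - (w t / x) ^ p) / x with hg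
  have hgeq : g = fun t => (D * (1 - p) / x + D * p / x ^ 2 * w t) - (w t ^ p) / (x ^ p * x) := by
    ext t
    simp only [hg]
    rw [Real.div_rpow (hw0 t) hx.le]
    field_simp
    ring
  have hxp : 0 < x ^ p := Real.rpow_pos_of_pos hx p
  have hgi : IntegrableOn g (Ioo a b) := by
    rw [hgeq]
    refine Integrable.sub (Integrable.add ?_ (hw.const_mul _)) (hwp.div_const _)
    exact integrableOn_const (by simp)
  have hfi : IntegrableOn (fun t => w t - x) (Ioo a b) :=
    Integrable.sub hw (integrableOn_const (by simp))
  have hmeas : MeasurableSet {t | w t ≤ q * x} := measurableSet_le hwm measurable_const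
  have hind : (fun t => if w t ≤ q * x then g t else 0) = {t | w t ≤ q * x}.indicator g := by
    ext t; simp [indicator_apply]
  have hgii : IntegrableOn ({t | w t ≤ q * x}.indicator g) (Ioo a b) :=
    Integrable.indicator hgi hmeas
  have hintf : ∀ c d, a ≤ c → c < d → d ≤ b →
      ∫ t in Ioo c d, (w t - x) = (∫ t in Ioo c d, w t) - (d - c) * x := by
    intro c d hc hcd hd
    rw [integral_sub (hw.mono_set (Ioo_subset_Ioo hc hd)) (integrableOn_const (by simp))]
    simp [hcd.le]
  have h0 : 0 ≤ ∫ t in Ioo a b, (w t - x) := by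
    rw [hintf a b le_rfl hab le_rfl]
    rw [avgR, le_div_iff₀ (by linarith)] at hxX
    linarith
  obtain ⟨G, hGm, hG0, hGae⟩ := exists_balanced_set hab hfi hgi h0 (by
    intro c d hc hcd hd h
    rw [hintf c d hc hcd hd] at h
    have hdc : 0 < d - c := by linarith
    have hwi : ∫ t in Ioo c d, w t = (d - c) * x := by linarith
    have hr := hRH c d hc hcd hd
    have hav : avgR w c d = x := by rw [avgR, hwi]; field_simp
    rw [hav, avgR, div_le_iff₀ hdc] at hr
    have hwi' := hw.mono_set (Ioo_subset_Ioo hc hd)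
    have hwpi' := hwp.mono_set (Ioo_subset_Ioo hc hd)
    have hci : IntegrableOn (fun _ : ℝ => D * (1 - p) / x) (Ioo c d) :=
      integrableOn_const (by simp)
    have h1 := integral_sub (hci.add (hwi'.const_mul (D * p / x ^ 2)))
      (hwpi'.div_const (x ^ p * x))
    simp only [Pi.add_apply] at h1
    rw [hgeq, h1, integral_add hci (hwi'.const_mul _), integral_const_mul, hwi]
    simp only [integral_const, MeasurableSet.univ, measureReal_restrict_apply, univ_inter,
      Real.volume_real_Ioo_of_le hcd.le, smul_eq_mul]
    have : (d - c) * (D * (1 - p) / x) + D * p / x ^ 2 * ((d - c) * x) = D * x ^ p * (d - c) /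
        (x ^ p * x) := by field_simp; ring
    rw [this, integral_div, ← sub_div]
    exact div_nonneg (by linarith) (by positivity))
  change IntegrableOn (fun t => if w t ≤ q * x then g t else 0) (Ioo a b) ∧
    0 ≤ ∫ t in Ioo a b, (fun t => if w t ≤ q * x then g t else 0) t
  rw [hind]
  refine ⟨hgii, hG0.trans ?_⟩
  rw [inter_comm, ← setIntegral_indicator hGm]
  refine integral_mono_ae (hgi.indicator hGm) hgii ?_
  refine (ae_restrict_iff' measurableSet_Ioo).2 ?_
  filter_upwards [hGae] with t ht htI
  by_cases htG : t ∈ G <;> by_cases hwt : w t ≤ q * x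
  · simp [htG, hwt]
  · have h1 := tangent_le_rpow hp hD hq hqD (r := w t / x) (by rw [le_div_iff₀ hx]; linarith)
    have h2 : g t ≤ 0 := div_nonpos_of_nonpos_of_nonneg (by linarith) hx.le
    simpa [htG, hwt] using h2
  · have h1 := ht htI htG
    have h2 := rpow_le_tangent hp hD hq hqD (r := w t / x) (by rw [le_div_iff₀ hx]; linarith)
      (by rw [div_le_iff₀ hx]; exact hwt)
    have h3 : 0 ≤ g t := div_nonneg (by linarith) hx.le
    simpa [htG, hwt] using h3
  · simp [htG, hwt]

theorem integrable_uncurry_of_integral_nonneg {α β : Type*} [MeasurableSpace α]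
    [MeasurableSpace β] {μ : Measure α} {ν : Measure β} [SFinite μ] [SFinite ν] {F : α → β → ℝ}
    (hF : Measurable (Function.uncurry F))
    (hInt : ∀ᵐ x ∂μ, Integrable (F x) ν ∧ 0 ≤ ∫ y, F x y ∂ν)
    (hfin : ∫⁻ y, ∫⁻ x, ENNReal.ofReal (F x y) ∂μ ∂ν ≠ ⊤) :
    Integrable (Function.uncurry F) (μ.prod ν) := by
  refine ⟨hF.aestronglyMeasurable, ?_⟩
  have hpos : Measurable fun z : α × β => ENNReal.ofReal (Function.uncurry F z) := hF.ennreal_ofReal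
  rw [← lintegral_lintegral_swap hpos.aemeasurable] at hfin
  rw [HasFiniteIntegral, lintegral_prod _ hF.enorm.aemeasurable]
  have hle : ∫⁻ x, ∫⁻ y, ‖Function.uncurry F (x, y)‖ₑ ∂ν ∂μ
      ≤ ∫⁻ x, 2 * ∫⁻ y, ENNReal.ofReal (F x y) ∂ν ∂μ := by
    refine lintegral_mono_ae ?_
    filter_upwards [hInt] with x hx
    have hFx : Measurable (F x) := hF.comp measurable_prodMk_left
    have h1 : ∫⁻ y, ‖F x y‖ₑ ∂ν = ∫⁻ y, ENNReal.ofReal (F x y) ∂ν +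
        ∫⁻ y, ENNReal.ofReal (-F x y) ∂ν := by
      rw [← lintegral_add_left hFx.ennreal_ofReal]
      refine lintegral_congr fun y => ?_
      rw [← ofReal_norm, Real.norm_eq_abs]
      rcases le_total 0 (F x y) with h | h
      · rw [abs_of_nonneg h, ENNReal.ofReal_of_nonpos (p := -F x y) (by linarith), add_zero]
      · rw [abs_of_nonpos h, ENNReal.ofReal_of_nonpos h, zero_add]
    have h2 := hx.2
    rw [integral_eq_lintegral_pos_part_sub_lintegral_neg_part hx.1, sub_nonneg] at h2
    have h3 : ∀ G : β → ℝ, Integrable G ν → ∫⁻ y, ENNReal.ofReal (G y) ∂ν ≠ ⊤ := fun G hG =>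
      hG.lintegral_lt_top.ne
    rw [ENNReal.toReal_le_toReal (h3 (fun y => -F x y) hx.1.neg) (h3 _ hx.1)] at h2
    change ∫⁻ y, ‖F x y‖ₑ ∂ν ≤ _
    rw [h1, two_mul]
    gcongr
  refine hle.trans_lt ?_
  rw [lintegral_const_mul' _ _ (by simp)]
  exact ENNReal.mul_lt_top (by simp) hfin.lt_top

theorem lintegral_levelKernel_le {p D q v X : ℝ} (hp : 1 < p) (hD : 1 < D) (hq : 1 < q)
    (hv : 0 ≤ v) :
    ∫⁻ x in Ioo 0 X, ENNReal.ofReal (levelKernel p D q x v)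
      ≤ ENNReal.ofReal (D * (1 + p * (q - 1)) * q * (p / (p - 1))) := by
  have hp0 : 0 < p - 1 := by linarith
  have hq0 : 0 < q := by linarith
  have hC : 0 < D * (1 + p * (q - 1)) := by
    have : 0 < p * (q - 1) := mul_pos (by linarith) (by linarith)
    exact mul_pos (by linarith) (by linarith)
  rcases hv.eq_or_lt with rfl | hv
  · rw [setLIntegral_congr_fun (g := fun _ => 0) measurableSet_Ioo]
    · simp
    · intro x hx
      have hx0 : 0 < x := hx.1
      simp only
      rw [ENNReal.ofReal_eq_zero, levelKernel, if_pos (by positivity)]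
      refine div_nonpos_of_nonpos_of_nonneg ?_ hx0.le
      rw [zero_div, Real.zero_rpow (by linarith)]
      nlinarith
  calc ∫⁻ x in Ioo 0 X, ENNReal.ofReal (levelKernel p D q x v)
      ≤ ∫⁻ x in Ioo 0 X, (Icc (v / q) (v * (p / (p - 1)))).indicator
          (fun _ => ENNReal.ofReal (D * (1 + p * (q - 1)) * q / v)) x := by
        refine setLIntegral_mono' measurableSet_Ioo fun x hx => ?_
        have hx0 : 0 < x := hx.1
        have hr : 0 ≤ (v / x) ^ p := by positivity
        rw [levelKernel]
        split_ifs with hvx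
        · by_cases hxv : x ≤ v * (p / (p - 1))
          · rw [indicator_of_mem (by
              refine ⟨?_, hxv⟩
              rw [div_le_iff₀ hq0]; linarith)]
            refine ENNReal.ofReal_le_ofReal ?_
            have h1 : v / x ≤ q := by rw [div_le_iff₀ hx0]; exact hvx
            have h2 : D * (1 + p * (v / x - 1)) - (v / x) ^ p ≤ D * (1 + p * (q - 1)) := by
              have : D * (1 + p * (v / x - 1)) ≤ D * (1 + p * (q - 1)) := by gcongr
              linarith
            calc (D * (1 + p * (v / x - 1)) - (v / x) ^ p) / x
                ≤ D * (1 + p * (q - 1)) / x := by gcongr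
              _ ≤ D * (1 + p * (q - 1)) * q / v := by
                  rw [div_le_div_iff₀ hx0 hv]
                  nlinarith
          · rw [ENNReal.ofReal_eq_zero.2]
            · exact zero_le
            · refine div_nonpos_of_nonpos_of_nonneg ?_ hx0.le
              have h1 : p * v < x * (p - 1) := by
                rw [not_le, ← mul_div_assoc, div_lt_iff₀ hp0] at hxv
                linarith
              have h2 : 1 + p * (v / x - 1) ≤ 0 := by
                have : 1 + p * (v / x - 1) = (p * v - x * (p - 1)) / x := by field_simp; ring
                rw [this]
                exact div_nonpos_of_nonpos_of_nonneg (by linarith) hx0.le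
              nlinarith
        · simp
    _ ≤ ∫⁻ x, (Icc (v / q) (v * (p / (p - 1)))).indicator
          (fun _ => ENNReal.ofReal (D * (1 + p * (q - 1)) * q / v)) x :=
        setLIntegral_le_lintegral _ _
    _ = ENNReal.ofReal (D * (1 + p * (q - 1)) * q / v) *
          ENNReal.ofReal (v * (p / (p - 1)) - v / q) := by
        rw [lintegral_indicator_const measurableSet_Icc, Real.volume_Icc]
    _ ≤ ENNReal.ofReal (D * (1 + p * (q - 1)) * q * (p / (p - 1))) := by
        rw [← ENNReal.ofReal_mul (by positivity)]
        refine ENNReal.ofReal_le_ofReal ?_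
        calc D * (1 + p * (q - 1)) * q / v * (v * (p / (p - 1)) - v / q)
            ≤ D * (1 + p * (q - 1)) * q / v * (v * (p / (p - 1))) := by
              gcongr
              have : 0 < v / q := by positivity
              linarith
          _ = _ := by field_simp

theorem integral_levelKernel {p D q v X : ℝ} (hp : 1 < p) (hD : 1 < D) (hq : 1 < q)
    (hqD : q ^ p = D * (1 + p * (q - 1))) (hv : 0 < v) (hX : 0 < X) :
    (v ≤ q * X → ∫ x in Ioo 0 X, levelKernel p D q x v = D * (p - 1) * Real.log (v / (q * X)) +
      p * D * (q - v / X) + ((v / X) ^ p - q ^ p) / p) ∧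
    ∫ x in Ioo 0 X, levelKernel p D q x v ≤ D * (p - 1) * Real.log (v / (q * X)) +
      p * D * (q - v / X) + ((v / X) ^ p - q ^ p) / p := by
  have hq0 : 0 < q := by linarith
  set g : ℝ → ℝ := fun x => (D * (1 + p * (v / x - 1)) - (v / x) ^ p) / x with hg
  set A : ℝ → ℝ := fun x => D * (1 - p) * Real.log x - p * D * (v / x) + (v / x) ^ p / p with hA
  have hpos : ∀ x ∈ uIcc (v / q) X, 0 < x := fun x hx =>
    (lt_min (div_pos hv hq0) hX).trans_le hx.1
  have hder : ∀ x ∈ uIcc (v / q) X, HasDerivAt A (g x) x := by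
    intro x hx
    have hx0 := hpos x hx
    have h1 : HasDerivAt (fun x => v / x) (-v / x ^ 2) x := by
      refine ((hasDerivAt_const x v).fun_div (hasDerivAt_id' x) hx0.ne').congr_deriv ?_
      simp
    have h2 := h1.rpow_const (p := p) (Or.inl (div_pos hv hx0).ne')
    have h3 := (((Real.hasDerivAt_log hx0.ne').const_mul (D * (1 - p))).sub
      (h1.const_mul (p * D))).add (h2.div_const p)
    refine h3.congr_deriv ?_
    have h4 : (v / x) ^ p = (v / x) ^ (p - 1) * (v / x) := by
      rw [← Real.rpow_add_one (div_pos hv hx0).ne']; simp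
    simp only [hg, h4]
    field_simp
    ring
  have hgc : ContinuousOn g (uIcc (v / q) X) := by
    have hd : ContinuousOn (fun x => v / x) (uIcc (v / q) X) :=
      continuousOn_const.div continuousOn_id fun x hx => (hpos x hx).ne'
    refine ContinuousOn.div ?_ continuousOn_id fun x hx => (hpos x hx).ne'
    refine ContinuousOn.sub ?_ (hd.rpow_const fun x hx => Or.inr (by linarith))
    exact continuousOn_const.mul (continuousOn_const.add
      (continuousOn_const.mul (hd.sub continuousOn_const)))
  have hInt := intervalIntegral.integral_eq_sub_of_hasDerivAt hder hgc.intervalIntegrable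
  have hAK : A X - A (v / q) = D * (p - 1) * Real.log (v / (q * X)) +
      p * D * (q - v / X) + ((v / X) ^ p - q ^ p) / p := by
    simp only [hA]
    rw [div_div_cancel₀ hv.ne', Real.log_div hv.ne' hq0.ne', Real.log_div hv.ne' (by positivity),
      Real.log_mul hq0.ne' hX.ne']
    ring
  rw [← hAK, ← hInt]
  have hcase : v ≤ q * X → ∫ x in Ioo 0 X, levelKernel p D q x v = ∫ x in (v / q)..X, g x := by
    intro h
    have hle : v / q ≤ X := by rw [div_le_iff₀ hq0]; linarith
    have hind : (fun x => levelKernel p D q x v) = (Ici (v / q)).indicator g := by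
      ext x
      simp [levelKernel, indicator_apply, hg, div_le_iff₀ hq0, mul_comm]
    have hset : Ioo 0 X ∩ Ici (v / q) = Ico (v / q) X := by
      ext x
      exact ⟨fun h => ⟨h.2, h.1.2⟩, fun h => ⟨⟨(div_pos hv hq0).trans_le h.1, h.2⟩, h.1⟩⟩
    rw [hind, setIntegral_indicator measurableSet_Ici, hset,
      intervalIntegral.integral_of_le hle, integral_Ioc_eq_integral_Ioo,
      integral_Ico_eq_integral_Ioo]
  refine ⟨hcase, ?_⟩
  rcases le_or_gt v (q * X) with h | h
  · exact (hcase h).le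
  · have hle : X ≤ v / q := by rw [le_div_iff₀ hq0]; linarith
    have hz : ∫ x in Ioo 0 X, levelKernel p D q x v = 0 := by
      refine setIntegral_eq_zero_of_forall_eq_zero fun x hx => ?_
      rw [levelKernel, if_neg]
      rw [not_le]
      exact (mul_lt_mul_of_pos_left hx.2 hq0).trans h
    rw [hz, intervalIntegral.integral_symm, ← intervalIntegral.integral_neg]
    refine intervalIntegral.integral_nonneg hle fun x hx => ?_
    have hx0 : 0 < x := hX.trans_le hx.1
    rw [neg_nonneg]
    refine div_nonpos_of_nonpos_of_nonneg ?_ hx0.le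
    have := tangent_le_rpow hp hD hq hqD (r := v / x) (by
      rw [le_div_iff₀ hx0]
      have := hx.2
      rw [le_div_iff₀ hq0] at this
      linarith)
    linarith

theorem measurable_levelKernel {p D q : ℝ} {w : ℝ → ℝ} (hwm : Measurable w) :
    Measurable (Function.uncurry fun x t => levelKernel p D q x (w t)) := by
  have hw2 : Measurable fun z : ℝ × ℝ => w z.2 := hwm.comp measurable_snd
  have hd : Measurable fun z : ℝ × ℝ => w z.2 / z.1 := hw2.div measurable_fst
  refine Measurable.ite (measurableSet_le hw2 (measurable_fst.const_mul q)) ?_ measurable_const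
  exact (((((hd.sub_const 1).const_mul p).const_add 1).const_mul D).sub
    (hd.pow_const p)).div measurable_fst

theorem not_integrableOn_levelKernel_zero {p D q X : ℝ} (hp : 1 < p) (hD : 1 < D) (hq : 1 < q)
    (hX : 0 < X) : ¬ IntegrableOn (fun x => levelKernel p D q x 0) (Ioo 0 X) := by
  intro h
  have h1 : IntegrableOn (fun x : ℝ => x⁻¹) (Ioo 0 X) := by
    refine IntegrableOn.congr_fun (h.const_mul (D * (1 - p))⁻¹) (fun x hx => ?_) measurableSet_Ioo
    have hx0 : 0 < x := hx.1
    have hDp : D * (1 - p) ≠ 0 := mul_ne_zero (by linarith) (by linarith)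
    simp only [levelKernel]
    rw [if_pos (by positivity), zero_div, Real.zero_rpow (by linarith)]
    have : D * (1 + p * (0 - 1)) - 0 = D * (1 - p) := by ring
    rw [this, div_eq_mul_inv, inv_mul_cancel_left₀ hDp]
  rw [← intervalIntegrable_iff_integrableOn_Ioo_of_le hX.le, intervalIntegrable_inv_iff] at h1
  rcases h1 with h1 | h1
  · exact hX.ne h1
  · exact h1 left_mem_uIcc

/-- The sharp logarithmic lower bound for a nontrivial reverse Hölder weight. -/
theorem integrableOn_log_and_le_avgR_log {p D q a b : ℝ} {w : ℝ → ℝ} (hp : 1 < p) (hD : 1 < D)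
    (hq : 1 < q) (hqD : q ^ p = D * (1 + p * (q - 1))) (hab : a < b) (hwm : Measurable w)
    (hw0 : ∀ t, 0 ≤ w t) (hw : IntegrableOn w (Ioo a b))
    (hwp : IntegrableOn (fun t => w t ^ p) (Ioo a b))
    (hRH : ∀ c d, a ≤ c → c < d → d ≤ b →
      avgR (fun t => w t ^ p) c d ≤ D * avgR w c d ^ p)
    (hX : 0 < avgR w a b) :
    IntegrableOn (fun t => Real.log (w t)) (Ioo a b) ∧
      Real.log (q * avgR w a b) - (q - 1) ≤ avgR (fun t => Real.log (w t)) a b := by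
  set X := avgR w a b with hXdef
  have hba : 0 < b - a := by linarith
  have hp0 : 0 < p := by linarith
  have hq0 : 0 < q := by linarith
  have hqX : 0 < q * X := mul_pos hq0 hX
  have hc0 : 0 < D * (p - 1) := mul_pos (by linarith) (by linarith)
  set F : ℝ → ℝ → ℝ := fun x t => levelKernel p D q x (w t) with hF
  have hFm : Measurable (Function.uncurry F) := measurable_levelKernel hwm
  have hlev : ∀ᵐ x ∂(volume.restrict (Ioo 0 X)),
      IntegrableOn (F x) (Ioo a b) ∧ 0 ≤ ∫ t in Ioo a b, F x t :=
    (ae_restrict_iff' measurableSet_Ioo).2 (Filter.Eventually.of_forall fun x hx =>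
      integral_level_nonneg hp hD hq hqD hab hwm hw0 hw hwp hRH hx.1 hx.2.le)
  have hFi : Integrable (Function.uncurry F)
      ((volume.restrict (Ioo 0 X)).prod (volume.restrict (Ioo a b))) := by
    refine integrable_uncurry_of_integral_nonneg hFm hlev (ne_of_lt ?_)
    refine lt_of_le_of_lt (lintegral_mono fun t =>
      lintegral_levelKernel_le (X := X) hp hD hq (hw0 t)) ?_
    rw [lintegral_const]
    exact ENNReal.mul_lt_top ENNReal.ofReal_lt_top (by simp)
  set k : ℝ → ℝ := fun t => ∫ x in Ioo 0 X, F x t with hk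
  have hki : IntegrableOn k (Ioo a b) := hFi.integral_prod_right
  have hk0 : 0 ≤ ∫ t in Ioo a b, k t := by
    rw [hk, ← integral_integral_swap hFi]
    exact integral_nonneg_of_ae (hlev.mono fun x hx => hx.2)
  have hwpos : ∀ᵐ t ∂(volume.restrict (Ioo a b)), 0 < w t := by
    filter_upwards [hFi.prod_left_ae] with t ht
    refine (hw0 t).lt_of_ne fun h => ?_
    simp only [Function.uncurry, hF, ← h] at ht
    exact not_integrableOn_levelKernel_zero hp hD hq hX ht
  set P : ℝ → ℝ := fun t => p * D * (q - w t / X) + ((w t / X) ^ p - q ^ p) / p with hP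
  have hPeq : P = fun t => ((p * D * q - q ^ p / p) - p * D / X * w t) +
      w t ^ p / (X ^ p * p) := by
    ext t
    have hXp : 0 < X ^ p := Real.rpow_pos_of_pos hX p
    simp only [hP]
    rw [Real.div_rpow (hw0 t) hX.le]
    field_simp
    ring
  have hci : ∀ c : ℝ, IntegrableOn (fun _ : ℝ => c) (Ioo a b) := fun c =>
    integrableOn_const (by simp)
  have hPi : IntegrableOn P (Ioo a b) := by
    rw [hPeq]
    exact ((hci _).sub (hw.const_mul _)).add (hwp.div_const _)
  have hlog : ∀ t, 0 < w t → Real.log (w t / (q * X)) = Real.log (w t) - Real.log (q * X) :=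
    fun t ht => Real.log_div ht.ne' hqX.ne'
  have hkK : ∀ᵐ t ∂(volume.restrict (Ioo a b)),
      k t ≤ D * (p - 1) * (Real.log (w t) - Real.log (q * X)) + P t := by
    filter_upwards [hwpos] with t ht
    rw [← hlog t ht]
    have := (integral_levelKernel hp hD hq hqD ht hX).2
    simp only [hP, ← add_assoc]
    exact this
  have hli : IntegrableOn (fun t => Real.log (w t) - Real.log (q * X)) (Ioo a b) := by
    have hdom : IntegrableOn (fun t => (|k t| + |P t|) / (D * (p - 1)) + w t / (q * X))
        (Ioo a b) := ((hki.abs.add hPi.abs).div_const _).add (hw.div_const _)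
    refine hdom.mono' ((hwm.log.sub_const _).aestronglyMeasurable) ?_
    filter_upwards [hwpos] with t ht
    have hpos : 0 ≤ w t / (q * X) := by positivity
    have hpos' : 0 ≤ (|k t| + |P t|) / (D * (p - 1)) := by positivity
    rw [Real.norm_eq_abs]
    rcases le_total (w t) (q * X) with h | h
    · have h1 := (integral_levelKernel hp hD hq hqD ht hX).1 h
      have h2 : Real.log (w t) - Real.log (q * X) = (k t - P t) / (D * (p - 1)) := by
        rw [eq_div_iff hc0.ne', ← hlog t ht]
        simp only [hk, hF, hP, h1]
        ring
      rw [h2, abs_div, abs_of_pos hc0]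
      have : |k t - P t| / (D * (p - 1)) ≤ (|k t| + |P t|) / (D * (p - 1)) := by
        gcongr
        exact abs_sub _ _
      linarith
    · rw [← hlog t ht, abs_of_nonneg (Real.log_nonneg (by rwa [le_div_iff₀ hqX, one_mul]))]
      have := Real.log_le_sub_one_of_pos (div_pos ht hqX)
      linarith
  have hlogi : IntegrableOn (fun t => Real.log (w t)) (Ioo a b) := by
    have := hli.add (hci (Real.log (q * X)))
    refine this.congr (Filter.Eventually.of_forall fun t => ?_)
    simp
  refine ⟨hlogi, ?_⟩
  have hI := hk0.trans (integral_mono_ae hki ((hli.const_mul _).add hPi) hkK)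
  have hwX : ∫ t in Ioo a b, w t = X * (b - a) := by rw [hXdef, avgR]; field_simp
  have hwpX : ∫ t in Ioo a b, w t ^ p ≤ D * X ^ p * (b - a) := by
    have := hRH a b le_rfl hab le_rfl
    rwa [avgR, div_le_iff₀ hba] at this
  have hXp : 0 < X ^ p := Real.rpow_pos_of_pos hX p
  have hcint : ∀ c : ℝ, ∫ _ in Ioo a b, c = c * (b - a) := by
    intro c
    simp [hab.le, mul_comm]
  have hPint : ∫ t in Ioo a b, P t ≤ D * (p - 1) * (q - 1) * (b - a) := by
    have h1 := integral_add ((hci (p * D * q - q ^ p / p)).sub (hw.const_mul (p * D / X)))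
      (hwp.div_const (X ^ p * p))
    simp only [Pi.sub_apply] at h1
    rw [hPeq, h1, integral_sub (hci _) (hw.const_mul _), integral_const_mul, integral_div, hcint,
      hwX]
    have h2 : (∫ t in Ioo a b, w t ^ p) / (X ^ p * p) ≤ D * X ^ p * (b - a) / (X ^ p * p) := by
      gcongr
    have h3 : D * X ^ p * (b - a) / (X ^ p * p) = D * (b - a) / p := by field_simp
    have h4 : (p * D * q - q ^ p / p) * (b - a) - p * D / X * (X * (b - a)) + D * (b - a) / p
        = D * (p - 1) * (q - 1) * (b - a) := by
      rw [hqD]; field_simp; ring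
    linarith
  have hsum : ∫ t in Ioo a b, (D * (p - 1) * (Real.log (w t) - Real.log (q * X)) + P t) =
      D * (p - 1) * ((∫ t in Ioo a b, Real.log (w t)) - Real.log (q * X) * (b - a)) +
        ∫ t in Ioo a b, P t := by
    rw [integral_add (hli.const_mul _) hPi, integral_const_mul, integral_sub hlogi (hci _), hcint]
  have hI' : 0 ≤ D * (p - 1) * ((∫ t in Ioo a b, Real.log (w t)) - Real.log (q * X) * (b - a)) +
        ∫ t in Ioo a b, P t := hsum ▸ hI
  have hfin : 0 ≤ D * (p - 1) * ((∫ t in Ioo a b, Real.log (w t)) -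
      (Real.log (q * X) - (q - 1)) * (b - a)) := by
    have : D * (p - 1) * ((∫ t in Ioo a b, Real.log (w t)) -
      (Real.log (q * X) - (q - 1)) * (b - a)) = D * (p - 1) * ((∫ t in Ioo a b, Real.log (w t)) -
        Real.log (q * X) * (b - a)) + D * (p - 1) * (q - 1) * (b - a) := by ring
    linarith
  rw [avgR, le_div_iff₀ hba]
  have := nonneg_of_mul_nonneg_right hfin hc0
  linarith

/-- Log-concavity of `s ↦ 1 - c ^ s`, between the exponents `1` and `1 + p * (q - 1)`. -/
theorem one_sub_rpow_div_le {p q c : ℝ} (hp : 1 < p) (hq : 1 < q) (hc : 0 ≤ c) (hc1 : c < 1) :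
    (1 - c ^ (1 + p * (q - 1))) / (1 - c) ≤ ((1 - c ^ q) / (1 - c)) ^ p := by
  have hp0 : 0 < p := by linarith
  have h1c : 0 < 1 - c := by linarith
  set s := 1 + p * (q - 1) with hs
  have hs0 : 0 < s := by
    have : 0 < p * (q - 1) := mul_pos hp0 (by linarith)
    linarith
  have hL : 0 ≤ 1 - c ^ s := by linarith [Real.rpow_le_one hc hc1.le hs0.le]
  have hi : 0 ≤ 1 / p := by positivity
  have hi' : 0 < 1 - 1 / p := by
    rw [sub_pos, div_lt_one hp0]; exact hp
  have h1 := Real.geom_mean_le_arith_mean2_weighted hi hi'.le hL h1c.le (by ring)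
  have h2 := Real.geom_mean_le_arith_mean2_weighted hi hi'.le (Real.rpow_nonneg hc s) hc (by ring)
  rw [← Real.rpow_mul hc, ← Real.rpow_add_of_nonneg hc (by positivity) hi'.le] at h2
  have he : s * (1 / p) + (1 - 1 / p) = q := by rw [hs]; field_simp; ring
  rw [he] at h2
  have h3 : (1 - c ^ s) ^ (1 / p) * (1 - c) ^ (1 - 1 / p) ≤ 1 - c ^ q := by nlinarith
  have h4 : ((1 - c ^ s) / (1 - c)) ^ (1 / p) ≤ (1 - c ^ q) / (1 - c) := by
    rw [le_div_iff₀ h1c, Real.div_rpow hL h1c.le]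
    rw [Real.rpow_sub h1c, Real.rpow_one] at h3
    have : (1 - c ^ s) ^ (1 / p) / (1 - c) ^ (1 / p) * (1 - c) =
      (1 - c ^ s) ^ (1 / p) * ((1 - c) / (1 - c) ^ (1 / p)) := by ring
    rwa [this]
  have h5 := Real.rpow_le_rpow (by positivity) h4 hp0.le
  rwa [← Real.rpow_mul (by positivity), one_div_mul_cancel hp0.ne', Real.rpow_one] at h5

theorem integral_max_rpow {r a b : ℝ} (hr : 0 ≤ r) (ha : 0 ≤ a) (hab : a ≤ b) :
    ∫ t in Ioo a b, max t 0 ^ r = (b ^ (r + 1) - a ^ (r + 1)) / (r + 1) := by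
  rw [← integral_rpow (Or.inl (by linarith)), intervalIntegral.integral_of_le hab,
    integral_Ioc_eq_integral_Ioo]
  refine setIntegral_congr_fun measurableSet_Ioo fun t ht => ?_
  rw [max_eq_left (ha.trans ht.1.le)]

/-- Reverse Hölder inequality for power weights on subintervals of the half line. -/
theorem avgR_max_rpow_le {p q a b : ℝ} (hp : 1 < p) (hq : 1 < q) (ha : 0 ≤ a) (hab : a < b) :
    avgR (fun t => (max t 0 ^ (q - 1)) ^ p) a b ≤
      q ^ p / (1 + p * (q - 1)) * avgR (fun t => max t 0 ^ (q - 1)) a b ^ p := by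
  have hb : 0 < b := ha.trans_lt hab
  have hq0 : 0 < q := by linarith
  have hpq : 0 < p * (q - 1) := mul_pos (by linarith) (by linarith)
  have hs0 : 0 < 1 + p * (q - 1) := by linarith
  have hba : 0 < b - a := by linarith
  obtain ⟨c, hc⟩ : ∃ c, c = a / b := ⟨_, rfl⟩
  have hac : a = b * c := by rw [hc]; field_simp
  have hc0 : 0 ≤ c := hc ▸ div_nonneg ha hb.le
  have hc1 : c < 1 := by rw [hc, div_lt_one hb]; exact hab
  have h1c : 0 < 1 - c := by linarith
  have hkey := one_sub_rpow_div_le hp hq hc0 hc1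
  have hcq : 0 ≤ 1 - c ^ q := by linarith [Real.rpow_le_one hc0 hc1.le hq0.le]
  simp only [avgR, ← Real.rpow_mul (le_max_right _ (0 : ℝ))]
  rw [integral_max_rpow (by nlinarith) ha hab.le, integral_max_rpow (by linarith) ha hab.le,
    sub_add_cancel, hac, Real.mul_rpow hb.le hc0, Real.mul_rpow hb.le hc0, mul_comm (q - 1) p,
    add_comm (p * (q - 1)) 1]
  have hbs : b ^ (1 + p * (q - 1)) = b * (b ^ (q - 1)) ^ p := by
    rw [Real.rpow_add hb, Real.rpow_one, ← Real.rpow_mul hb.le, mul_comm p]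
  have hbq : b ^ q = b * b ^ (q - 1) := by
    rw [mul_comm, ← Real.rpow_add_one hb.ne', sub_add_cancel]
  have e1 : (b ^ (1 + p * (q - 1)) - b ^ (1 + p * (q - 1)) * c ^ (1 + p * (q - 1))) /
      (1 + p * (q - 1)) / (b - b * c) = (b ^ (q - 1)) ^ p / (1 + p * (q - 1)) *
        ((1 - c ^ (1 + p * (q - 1))) / (1 - c)) := by
    rw [hbs, ← mul_one_sub, ← mul_one_sub]
    field_simp
  have e2 : (b ^ q - b ^ q * c ^ q) / q / (b - b * c) =
      b ^ (q - 1) / q * ((1 - c ^ q) / (1 - c)) := by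
    rw [hbq, ← mul_one_sub, ← mul_one_sub]
    field_simp
  have hbq0 : 0 ≤ b ^ (q - 1) := Real.rpow_nonneg hb.le _
  rw [e1, e2, Real.mul_rpow (by positivity) (by positivity), Real.div_rpow hbq0 hq0.le]
  have hqp : 0 < q ^ p := Real.rpow_pos_of_pos hq0 p
  calc _ ≤ (b ^ (q - 1)) ^ p / (1 + p * (q - 1)) * ((1 - c ^ q) / (1 - c)) ^ p := by gcongr
    _ = _ := by field_simp

theorem integrableOn_log_max_rpow (r : ℝ) :
    IntegrableOn (fun t => Real.log (max t 0 ^ r)) (Ioo 0 1) := by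
  have h : IntegrableOn (fun t => r * Real.log t) (Ioo 0 1) :=
    ((intervalIntegrable_iff_integrableOn_Ioo_of_le zero_le_one).1
      intervalIntegral.intervalIntegrable_log').const_mul r
  refine h.congr_fun (fun t ht => ?_) measurableSet_Ioo
  simp only
  rw [max_eq_left ht.1.le, Real.log_rpow ht.1]

theorem avgR_log_max_rpow (r : ℝ) : avgR (fun t => Real.log (max t 0 ^ r)) 0 1 = -r := by
  have h : ∫ t in Ioo (0 : ℝ) 1, Real.log (max t 0 ^ r) = ∫ t in Ioo (0 : ℝ) 1, r * Real.log t := by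
    refine setIntegral_congr_fun measurableSet_Ioo fun t ht => ?_
    rw [max_eq_left ht.1.le, Real.log_rpow ht.1]
  rw [avgR, h, integral_const_mul, ← integral_Ioc_eq_integral_Ioo,
    ← intervalIntegral.integral_of_le zero_le_one, integral_log]
  simp

theorem statement3 (p δ qs : ℝ) (hp : 1 < p) (hδ : 1 < δ)
    (hqs1 : 1 < qs) (hqs : ((qs / δ) ^ p - 1) / (qs - 1) = p) :
    (∀ A B : ℝ, A < B → ∀ w : ℝ → ℝ, MemRHreal p δ A B w →
      ∀ a b, A ≤ a → a < b → b ≤ B →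
        IntegrableOn (fun t => Real.log (w t)) (Set.Ioo a b) ∧
        avgR w a b * Real.exp (-(avgR (fun t => Real.log (w t)) a b))
          ≤ (1 / qs) * Real.exp (qs - 1)) ∧
    (∀ C : ℝ, C < (1 / qs) * Real.exp (qs - 1) →
      ∃ w : ℝ → ℝ, MemRHreal p δ 0 1 w ∧ ∃ a b : ℝ, 0 ≤ a ∧ a < b ∧ b ≤ 1 ∧
        IntegrableOn (fun t => Real.log (w t)) (Set.Ioo a b) ∧
        C < avgR w a b * Real.exp (-(avgR (fun t => Real.log (w t)) a b))) := by
  have hp0 : 0 < p := by linarith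
  have hδ0 : 0 < δ := by linarith
  have hqs0 : 0 < qs := by linarith
  have hδp : 0 < δ ^ p := Real.rpow_pos_of_pos hδ0 p
  have hs0 : 0 < 1 + p * (qs - 1) := by
    have : 0 < p * (qs - 1) := mul_pos hp0 (by linarith)
    linarith
  have hD : 1 < δ ^ p := Real.one_lt_rpow hδ hp0
  have hqD : qs ^ p = δ ^ p * (1 + p * (qs - 1)) := by
    rw [div_eq_iff (by linarith), Real.div_rpow hqs0.le hδ0.le] at hqs
    have : qs ^ p / δ ^ p = 1 + p * (qs - 1) := by linarith
    rw [← this]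
    field_simp
  constructor
  · rintro A B - w ⟨hwm, hw0, hw, hwp, hRH⟩ a b hAa hab hbB
    have hsub : Ioo a b ⊆ Ioo A B := Ioo_subset_Ioo hAa hbB
    have hba : 0 < b - a := by linarith
    have hX0 : 0 ≤ avgR w a b := div_nonneg (integral_nonneg hw0) hba.le
    rcases hX0.eq_or_lt with h | hX
    · have hInt : ∫ t in Ioo a b, w t = 0 := by
        rw [eq_comm, avgR, div_eq_zero_iff] at h
        exact h.resolve_right hba.ne'
      rw [integral_eq_zero_iff_of_nonneg hw0 (hw.mono_set hsub)] at hInt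
      refine ⟨(integrable_zero ℝ ℝ _).congr ?_, ?_⟩
      · filter_upwards [hInt] with t ht
        simp [ht]
      · rw [← h, zero_mul]
        positivity
    · obtain ⟨hli, hlog⟩ := integrableOn_log_and_le_avgR_log hp hD hqs1 hqD hab hwm hw0
        (hw.mono_set hsub) (hwp.mono_set hsub)
        (fun c d hc hcd hd => hRH c d (hAa.trans hc) hcd (hd.trans hbB)) hX
      refine ⟨hli, ?_⟩
      calc avgR w a b * Real.exp (-avgR (fun t => Real.log (w t)) a b)
          ≤ avgR w a b * Real.exp (qs - 1 - Real.log (qs * avgR w a b)) := by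
            gcongr
            linarith
        _ = 1 / qs * Real.exp (qs - 1) := by
            rw [Real.exp_sub, Real.exp_log (by positivity)]
            field_simp
  · intro C hC
    have hcont : ∀ r : ℝ, 0 ≤ r → Continuous fun t : ℝ => max t 0 ^ r := fun r hr =>
      (continuous_id.max continuous_const).rpow_const fun _ => Or.inr hr
    have hci : ∀ f : ℝ → ℝ, Continuous f → IntegrableOn f (Ioo 0 1) := fun f hf =>
      (hf.continuousOn.integrableOn_compact isCompact_Icc).mono_set Ioo_subset_Icc_self
    have hc := hcont (qs - 1) (by linarith)
    refine ⟨fun t => max t 0 ^ (qs - 1), ⟨hc.measurable,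
      fun t => Real.rpow_nonneg (le_max_right _ _) _, hci _ hc,
      hci _ (hc.rpow_const fun _ => Or.inr hp0.le), fun a b ha hab _ => ?_⟩,
      0, 1, le_rfl, zero_lt_one, le_rfl, integrableOn_log_max_rpow _, ?_⟩
    · have hδq : δ ^ p = qs ^ p / (1 + p * (qs - 1)) := by rw [hqD]; field_simp
      rw [hδq]
      exact avgR_max_rpow_le hp hqs1 ha hab
    · rw [avgR_log_max_rpow, neg_neg, avgR, integral_max_rpow (by linarith) le_rfl zero_le_one]
      simpa [hqs0.ne'] using hC
end
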